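/- arXiv:0711.0312 — 2 statements merged into one kernel-verified Lean document; each statement's English description precedes it below -/
import Mathlib

section
/- (Harris) Let a_n = (1/8)·log²n, b_n = (1/√24)·log^{3/2} n, and φ(x) = (1/√(2π)) ∫_{−∞}^x e^{−t²/2} dt. Then for every fixed real number x, the probability, under the uniform distribution P_n on Ω_n, of the event { f : (log T(f) − a_n)/b_n ≤ x } converges to φ(x) as n → ∞. -/
open scoped Classical
open Function

namespace IterMap

noncomputable section

/-- A vertex `v` is cyclic for `f` if some positive iterate of `f` fixes `v`. -/
def IsCyclic {n : ℕ} (f : Fin n → Fin n) (v : Fin n) : Prop :=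
  ∃ t, 0 < t ∧ f^[t] v = v

theorem isCyclic_apply {n : ℕ} {f : Fin n → Fin n} {v : Fin n} (h : IsCyclic f v) :
    IsCyclic f (f v) := by
  obtain ⟨t, ht, hv⟩ := h
  refine ⟨t, ht, ?_⟩
  calc f^[t] (f v) = f^[t + 1] v := (Function.iterate_succ_apply f t v).symm
    _ = f (f^[t] v) := Function.iterate_succ_apply' f t v
    _ = f v := by rw [hv]

/-- The permutation induced by `f` on its cyclic vertices. -/
def cyclicPerm {n : ℕ} (f : Fin n → Fin n) :
    Equiv.Perm {v : Fin n // IsCyclic f v} :=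
  Equiv.ofBijective (fun v => ⟨f v.1, isCyclic_apply v.2⟩) (by
    rw [← Finite.injective_iff_bijective]
    intro u v huv
    have h1 : f u.1 = f v.1 := congrArg Subtype.val huv
    obtain ⟨s, hs, hsu⟩ := u.2
    obtain ⟨t, ht, htv⟩ := v.2
    have hu : f^[s * t] u.1 = u.1 := by
      rw [Function.iterate_mul]
      exact Function.iterate_fixed hsu t
    have hv : f^[s * t] v.1 = v.1 := by
      rw [mul_comm, Function.iterate_mul]
      exact Function.iterate_fixed htv s
    have hst : 0 < s * t := Nat.mul_pos hs ht
    obtain ⟨k, hk⟩ : ∃ k, s * t = k + 1 := ⟨s * t - 1, by omega⟩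
    apply Subtype.ext
    calc u.1 = f^[s * t] u.1 := hu.symm
      _ = f^[k] (f u.1) := by rw [hk, Function.iterate_succ_apply]
      _ = f^[k] (f v.1) := by rw [h1]
      _ = f^[s * t] v.1 := by rw [hk, Function.iterate_succ_apply]
      _ = v.1 := hv)

/-- `T f`: the (eventual) period of the sequence of iterates of `f`. -/
def T {n : ℕ} (f : Fin n → Fin n) : ℕ :=
  sInf {T : ℕ | 0 < T ∧ ∀ m, n ≤ m → f^[m + T] = f^[m]}

/-- `B f`: the product of the lengths of the cycles of `f`. -/
def B {n : ℕ} (f : Fin n → Fin n) : ℕ :=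
  (cyclicPerm f).cycleType.prod

/-- `Z f`: the number of cyclic vertices of `f`. -/
def Z {n : ℕ} (f : Fin n → Fin n) : ℕ :=
  Nat.card {v : Fin n // IsCyclic f v}

/-- `O f`: the number of distinct positive iterates of `f`. -/
def O {n : ℕ} (f : Fin n → Fin n) : ℕ :=
  Nat.card {g : Fin n → Fin n // ∃ t, 0 < t ∧ g = f^[t]}

/-- `f` is connected if its functional graph has one weak component. -/
def Connected {n : ℕ} (f : Fin n → Fin n) : Prop :=
  ∀ u v : Fin n, ∃ s t : ℕ, f^[s] u = f^[t] v

/-- The set of connected mappings on `[n]`. -/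
def Un (n : ℕ) : Finset (Fin n → Fin n) :=
  Finset.univ.filter fun f => Connected f

/-- `kappa n`: the average cycle length of a uniform random connected mapping. -/
def kappa (n : ℕ) : ℝ :=
  (∑ f ∈ Un n, (Z f : ℝ)) / (Un n).card

def c (d : ℕ) : ℝ :=
  ((kappa d - 1) / d) * Real.exp (-(d : ℝ)) *
    ∑ k ∈ Finset.range d, (d : ℝ) ^ k / (k.factorial : ℝ)

def F (z : ℝ) : ℝ := (1 / (1 - z)) * Real.exp (∑' d : ℕ, c d * z ^ d)

def mu (m : ℕ) : ℝ := iteratedDeriv m F 0 / (m.factorial : ℝ)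

def g (s : ℝ) : ℝ := ∑' d : ℕ, c d * Real.exp (-(d : ℝ) * s)

/-- `M m`: the average order of a uniform random permutation of `[m]`. -/
def M (m : ℕ) : ℝ :=
  (∑ σ : Equiv.Perm (Fin m), (orderOf σ : ℝ)) / (m.factorial : ℝ)

def I : ℝ :=
  ∫ t in Set.Ioi (0 : ℝ), Real.log (Real.log (Real.exp 1 / (1 - Real.exp (-t))))

def beta0 : ℝ := Real.sqrt (8 * I)

def k0 : ℝ := (3 / 2) * (3 * I) ^ ((2 : ℝ) / 3)

end

section Aux
open scoped Classical
open Function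

set_option linter.unusedSectionVars false
section Comb
variable {α : Type} [Fintype α] [DecidableEq α]

def IsCyc (f : α → α) (γ : Finset α) : Prop :=
  γ.Nonempty ∧ (∀ x ∈ γ, f x ∈ γ) ∧ ∀ x ∈ γ, ∀ y ∈ γ, ∃ i, f^[i] x = y

noncomputable def cyc (f : α → α) : Finset (Finset α) := Finset.univ.filter (IsCyc f)

lemma mem_cyc {f : α → α} {γ : Finset α} : γ ∈ cyc f ↔ IsCyc f γ := by simp [cyc]

noncomputable def Pm (A : Finset α) : Finset (α → α) :=
  Finset.univ.filter (fun f => A.image f = A ∧ ∀ x, x ∉ A → f x = x)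

noncomputable def Cy (A : Finset α) : Finset (α → α) :=
  Finset.univ.filter (fun f => IsCyc f A ∧ ∀ x, x ∉ A → f x = x)

noncomputable def Off (A : Finset α) : Finset (α → α) :=
  Finset.univ.filter (fun f => ∀ x, x ∈ A → f x = x)

def mrg (A : Finset α) (f g : α → α) : α → α := fun x => if x ∈ A then f x else g x

lemma IsCyc.iterate_mem {f : α → α} {γ : Finset α} (h : IsCyc f γ) {x : α} (hx : x ∈ γ) (i : ℕ) :
    f^[i] x ∈ γ := by
  induction i with
  | zero => simpa
  | succ i ih => rw [iterate_succ_apply']; exact h.2.1 _ ih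

lemma IsCyc.congr {f f' : α → α} {γ : Finset α} (h : IsCyc f γ) (he : ∀ x ∈ γ, f x = f' x) :
    IsCyc f' γ := by
  have hi : ∀ i, ∀ x ∈ γ, f'^[i] x = f^[i] x := by
    intro i x hx
    induction i with
    | zero => rfl
    | succ i ih =>
      rw [iterate_succ_apply', iterate_succ_apply', ih, he _ (h.iterate_mem hx i)]
  refine ⟨h.1, fun x hx => he x hx ▸ h.2.1 x hx, fun x hx y hy => ?_⟩
  obtain ⟨i, hi'⟩ := h.2.2 x hx y hy
  exact ⟨i, by rw [hi i x hx, hi']⟩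

lemma isCyc_congr {f f' : α → α} {γ : Finset α} (he : ∀ x ∈ γ, f x = f' x) :
    IsCyc f γ ↔ IsCyc f' γ :=
  ⟨fun h => h.congr he, fun h => h.congr fun x hx => (he x hx).symm⟩

lemma IsCyc.sub {f : α → α} {γ δ : Finset α} (h : IsCyc f γ) (hd : IsCyc f δ) {x : α}
    (hx : x ∈ γ) (hx' : x ∈ δ) : γ ⊆ δ := by
  intro y hy
  obtain ⟨i, rfl⟩ := h.2.2 x hx y hy
  exact hd.iterate_mem hx' i

lemma IsCyc.eq_of_mem {f : α → α} {γ δ : Finset α} (h : IsCyc f γ) (hd : IsCyc f δ) {x : α}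
    (hx : x ∈ γ) (hx' : x ∈ δ) : γ = δ :=
  Finset.Subset.antisymm (h.sub hd hx hx') (hd.sub h hx' hx)

lemma IsCyc.image {f : α → α} {γ : Finset α} (h : IsCyc f γ) : γ.image f = γ := by
  apply Finset.Subset.antisymm
  · intro y hy
    obtain ⟨x, hx, rfl⟩ := Finset.mem_image.1 hy
    exact h.2.1 x hx
  · intro y hy
    obtain ⟨i, hi⟩ := h.2.2 (f y) (h.2.1 y hy) y hy
    rw [Finset.mem_image]
    refine ⟨f^[i] y, h.iterate_mem hy i, ?_⟩
    rw [← iterate_succ_apply' f, iterate_succ_apply, hi]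

lemma injOn_of_image {f : α → α} {A : Finset α} (h : A.image f = A) : Set.InjOn f A := by
  rw [← Finset.card_image_iff, h]

lemma iterate_mem_of_image {f : α → α} {A : Finset α} (h : A.image f = A) {x : α} (hx : x ∈ A)
    (i : ℕ) : f^[i] x ∈ A := by
  induction i with
  | zero => simpa
  | succ i ih =>
    rw [iterate_succ_apply']
    exact h ▸ Finset.mem_image_of_mem f ih

lemma exists_period {f : α → α} {A : Finset α} (h : A.image f = A) {x : α} (hx : x ∈ A) :
    ∃ p, 0 < p ∧ f^[p] x = x := by
  obtain ⟨i, j, hij, he⟩ := Finite.exists_ne_map_eq_of_infinite (fun i : ℕ => f^[i] x)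
  wlog hlt : i < j generalizing i j
  · exact this j i hij.symm he.symm (lt_of_le_of_ne (not_lt.1 hlt) hij.symm)
  have key : ∀ i d, f^[i] x = f^[i + d] x → x = f^[d] x := by
    intro i d
    induction i with
    | zero => simp
    | succ i ih =>
      intro hh
      apply ih
      rw [show i + 1 + d = (i + d) + 1 by ring, iterate_succ_apply', iterate_succ_apply'] at hh
      exact injOn_of_image h (iterate_mem_of_image h hx i) (iterate_mem_of_image h hx _) hh
  refine ⟨j - i, by omega, (key i (j - i) ?_).symm⟩
  rw [Nat.add_sub_cancel' hlt.le]; exact he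

lemma isCyc_orbit {f : α → α} {x : α} (h : ∃ p, 0 < p ∧ f^[p] x = x) :
    IsCyc f (Finset.univ.filter fun y => ∃ i, f^[i] x = y) := by
  obtain ⟨p, hp, hx⟩ := h
  refine ⟨⟨x, by simp; exact ⟨0, rfl⟩⟩, ?_, ?_⟩
  · simp only [Finset.mem_filter, Finset.mem_univ, true_and]
    rintro _ ⟨i, rfl⟩
    exact ⟨i + 1, iterate_succ_apply' f i x⟩
  · simp only [Finset.mem_filter, Finset.mem_univ, true_and]
    rintro _ ⟨i, rfl⟩ _ ⟨j, rfl⟩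
    refine ⟨j + (i * (p - 1)), ?_⟩
    rw [← iterate_add_apply, show j + i * (p - 1) + i = j + p * i by
      obtain ⟨q, rfl⟩ : ∃ q, p = q + 1 := ⟨p - 1, by omega⟩
      simp; ring, iterate_add_apply, iterate_mul, iterate_fixed hx]

lemma exists_cyc {f : α → α} {A : Finset α} (h : A.image f = A) {x : α} (hx : x ∈ A) :
    ∃ γ, IsCyc f γ ∧ x ∈ γ ∧ γ ⊆ A := by
  refine ⟨_, isCyc_orbit (exists_period h hx), by simp; exact ⟨0, rfl⟩, ?_⟩
  intro y hy
  simp only [Finset.mem_filter, Finset.mem_univ, true_and] at hy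
  obtain ⟨i, rfl⟩ := hy
  exact iterate_mem_of_image h hx i

lemma image_sdiff {f : α → α} {A γ : Finset α} (h : A.image f = A) (hg : γ.image f = γ)
    (hs : γ ⊆ A) : (A \ γ).image f = A \ γ := by
  have hinj := injOn_of_image h
  have : (A \ γ).image f ⊆ A \ γ := by
    intro y hy
    obtain ⟨x, hx, rfl⟩ := Finset.mem_image.1 hy
    rw [Finset.mem_sdiff] at hx ⊢
    refine ⟨h ▸ Finset.mem_image_of_mem f hx.1, fun hc => hx.2 ?_⟩
    rw [← hg] at hc
    obtain ⟨z, hz, hzx⟩ := Finset.mem_image.1 hc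
    rw [← hinj (hs hz) hx.1 hzx]; exact hz
  refine Finset.eq_of_subset_of_card_le this ?_
  rw [Finset.card_image_of_injOn (hinj.mono (by simp))]

variable {R : Type} [Field R] [CharZero R]

noncomputable def wt (w : ℕ → R) (A : Finset α) (f : α → α) : R :=
  ∏ γ ∈ (cyc f).filter (· ⊆ A), w γ.card

noncomputable def Wt (w : ℕ → R) (A : Finset α) : R := ∑ f ∈ Pm A, wt w A f

lemma wt_congr (w : ℕ → R) {A : Finset α} {f f' : α → α} (h : ∀ x ∈ A, f x = f' x) :
    wt w A f = wt w A f' := by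
  unfold wt
  congr 1
  ext γ
  simp only [Finset.mem_filter, mem_cyc]
  constructor
  · rintro ⟨h1, h2⟩; exact ⟨h1.congr fun x hx => h x (h2 hx), h2⟩
  · rintro ⟨h1, h2⟩; exact ⟨h1.congr fun x hx => (h x (h2 hx)).symm, h2⟩

lemma wt_split (w : ℕ → R) {A γ : Finset α} {f : α → α} (hg : IsCyc f γ) (hs : γ ⊆ A) :
    wt w A f = w γ.card * wt w (A \ γ) f := by
  unfold wt
  have : (cyc f).filter (· ⊆ A) = insert γ ((cyc f).filter (· ⊆ A \ γ)) := by
    ext δ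
    simp only [Finset.mem_filter, mem_cyc, Finset.mem_insert]
    constructor
    · rintro ⟨h1, h2⟩
      by_cases hd : δ = γ
      · exact Or.inl hd
      · refine Or.inr ⟨h1, fun x hx => Finset.mem_sdiff.2 ⟨h2 hx, fun hx' => hd ?_⟩⟩
        exact h1.eq_of_mem hg hx hx'
    · rintro (rfl | ⟨h1, h2⟩)
      · exact ⟨hg, hs⟩
      · exact ⟨h1, h2.trans Finset.sdiff_subset⟩
  rw [this, Finset.prod_insert]
  simp only [Finset.mem_filter, not_and]
  intro _ hc
  obtain ⟨x, hx⟩ := hg.1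
  exact (Finset.mem_sdiff.1 (hc hx)).2 hx

lemma card_eq_sum_cyc {f : α → α} {A : Finset α} (h : A.image f = A) :
    A.card = ∑ γ ∈ (cyc f).filter (· ⊆ A), γ.card := by
  rw [← Finset.card_biUnion]
  · congr 1
    ext x
    simp only [Finset.mem_biUnion, Finset.mem_filter, mem_cyc]
    constructor
    · intro hx
      obtain ⟨γ, h1, h2, h3⟩ := exists_cyc h hx
      exact ⟨γ, ⟨h1, h3⟩, h2⟩
    · rintro ⟨γ, ⟨_, h3⟩, h2⟩; exact h3 h2
  · intro γ hγ δ hδ hne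
    rw [Finset.mem_coe, Finset.mem_filter, mem_cyc] at hγ hδ
    rw [Function.onFun_apply, Finset.disjoint_left]
    intro x hx hx'
    exact hne (hγ.1.eq_of_mem hδ.1 hx hx')

lemma mrg_cy_pm {A γ : Finset α} (hs : γ ⊆ A) (w : ℕ → R) :
    ∑ f ∈ (Pm A).filter (fun f => IsCyc f γ), wt w A f
      = w γ.card * ((Cy γ).card * Wt w (A \ γ)) := by
  have : ((Cy γ).card : R) * Wt w (A \ γ) = ∑ p ∈ Cy γ ×ˢ Pm (A \ γ), wt w (A \ γ) p.2 := by
    rw [Finset.sum_product]; simp [Wt]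
  rw [this, Finset.mul_sum]
  refine Finset.sum_bij' (fun f _ => (mrg γ f id, mrg (A \ γ) f id)) (fun p _ => mrg γ p.1 p.2)
    ?_ ?_ ?_ ?_ ?_
  · intro f hf
    simp only [Finset.mem_filter, Pm, Finset.mem_univ, true_and] at hf
    simp only [Finset.mem_product, Cy, Pm, Finset.mem_filter, Finset.mem_univ, true_and]
    refine ⟨⟨hf.2.congr ?_, ?_⟩, ?_, ?_⟩
    · intro x hx; simp [mrg, hx]
    · intro x hx; simp [mrg, hx]
    · rw [← image_sdiff hf.1.1 hf.2.image hs]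
      rw [image_sdiff hf.1.1 hf.2.image hs]
      conv_rhs => rw [← image_sdiff hf.1.1 hf.2.image hs]
      apply Finset.image_congr
      intro x hx
      simp only [mrg]; rw [if_pos (by exact_mod_cast hx)]
    · intro x hx; simp only [mrg]; rw [if_neg hx]; rfl
  · rintro ⟨f1, f2⟩ hp
    simp only [Finset.mem_product, Cy, Pm, Finset.mem_filter, Finset.mem_univ, true_and] at hp
    simp only [Finset.mem_filter, Pm, Finset.mem_univ, true_and]
    have hc : IsCyc (mrg γ f1 f2) γ := hp.1.1.congr (by intro x hx; simp [mrg, hx])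
    refine ⟨⟨?_, ?_⟩, hc⟩
    · conv_lhs => rw [← Finset.union_sdiff_of_subset hs]
      rw [Finset.image_union, hc.image]
      have : (A \ γ).image (mrg γ f1 f2) = A \ γ := by
        conv_rhs => rw [← hp.2.1]
        apply Finset.image_congr
        intro x hx
        simp only [Finset.coe_sdiff, Set.mem_sdiff, Finset.mem_coe] at hx
        simp [mrg, hx.2]
      rw [this, Finset.union_sdiff_of_subset hs]
    · intro x hx
      have h1 : x ∉ γ := fun h => hx (hs h)
      simp only [mrg, if_neg h1]
      exact hp.2.2 x (fun h => hx (Finset.mem_sdiff.1 h).1)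
  · intro f hf
    simp only [Finset.mem_filter, Pm, Finset.mem_univ, true_and] at hf
    funext x
    simp only [mrg]
    by_cases h1 : x ∈ γ
    · simp [h1]
    · by_cases h2 : x ∈ A
      · simp [h1, h2]
      · simp [h1, h2, hf.1.2 x h2]
  · rintro ⟨f1, f2⟩ hp
    simp only [Finset.mem_product, Cy, Pm, Finset.mem_filter, Finset.mem_univ, true_and] at hp
    refine Prod.ext ?_ ?_
    · funext x
      by_cases h1 : x ∈ γ
      · simp [mrg, h1]
      · simp [mrg, h1, hp.1.2 x h1]
    · funext x
      by_cases h1 : x ∈ A \ γ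
      · have := Finset.mem_sdiff.1 h1
        simp [mrg, this.1, this.2]
      · simp only [mrg, if_neg h1]
        exact (hp.2.2 x h1).symm
  · intro f hf
    simp only [Finset.mem_filter] at hf
    rw [wt_split w hf.2 hs]
    congr 1
    apply wt_congr
    intro x hx
    simp [mrg, hx]

lemma Wt_rec (w : ℕ → R) (A : Finset α) :
    (A.card : R) * Wt w A
      = ∑ γ ∈ A.powerset, (γ.card : R) * (w γ.card * ((Cy γ).card * Wt w (A \ γ))) := by
  have : ∀ γ ∈ A.powerset, (γ.card : R) * (w γ.card * ((Cy γ).card * Wt w (A \ γ)))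
      = ∑ f ∈ Pm A, if IsCyc f γ then (γ.card : R) * wt w A f else 0 := by
    intro γ hγ
    rw [← mrg_cy_pm (Finset.mem_powerset.1 hγ), Finset.mul_sum, Finset.sum_filter]
  rw [Finset.sum_congr rfl this, Finset.sum_comm, Wt, Finset.mul_sum]
  refine Finset.sum_congr rfl fun f hf => ?_
  simp only [Pm, Finset.mem_filter, Finset.mem_univ, true_and] at hf
  conv_lhs => rw [card_eq_sum_cyc hf.1]
  rw [← Finset.sum_filter, ← Finset.sum_mul, Nat.cast_sum]
  congr 1
  refine Finset.sum_congr ?_ fun _ _ => rfl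
  ext γ
  simp only [Finset.mem_filter, mem_cyc, Finset.mem_powerset]
  tauto

lemma card_Pm (A : Finset α) : (Pm A).card = A.card.factorial := by
  have h1 : Fintype.card {f : Equiv.Perm α // ∀ a, a ∉ A → f a = a} = A.card.factorial := by
    rw [← Fintype.card_congr (Equiv.Perm.subtypeEquivSubtypePerm (fun x => x ∈ A)),
      Fintype.card_perm, Fintype.card_coe]
  rw [← h1, Fintype.card_subtype]
  symm
  refine Finset.card_bij (fun f _ => ⇑f) ?_ ?_ ?_
  · intro f hf
    simp only [Finset.mem_filter, Finset.mem_univ, true_and, Pm] at hf ⊢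
    refine ⟨?_, hf⟩
    refine Finset.eq_of_subset_of_card_le ?_ (by rw [Finset.card_image_of_injective _ f.injective])
    intro y hy
    obtain ⟨x, hx, rfl⟩ := Finset.mem_image.1 hy
    by_contra hc
    have := hf _ hc
    rw [f.injective this] at hc
    exact hc hx
  · intro f _ g _ h
    exact DFunLike.coe_injective h
  · intro f hf
    simp only [Finset.mem_filter, Finset.mem_univ, true_and, Pm] at hf ⊢
    have hb : Function.Bijective f := by
      rw [← Finite.injective_iff_bijective]
      intro x y hxy
      by_cases hx : x ∈ A <;> by_cases hy : y ∈ A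
      · exact injOn_of_image hf.1 hx hy hxy
      · exfalso
        rw [hf.2 y hy] at hxy
        exact hy (hxy ▸ hf.1 ▸ Finset.mem_image_of_mem f hx)
      · exfalso
        rw [hf.2 x hx] at hxy
        exact hx (hxy ▸ hf.1 ▸ Finset.mem_image_of_mem f hy)
      · rwa [hf.2 x hx, hf.2 y hy] at hxy
    exact ⟨Equiv.ofBijective f hb, hf.2, rfl⟩

lemma Wt_one (A : Finset α) : Wt (fun _ => (1 : ℚ)) A = A.card.factorial := by
  simp [Wt, wt, card_Pm]

lemma card_Cy (A : Finset α) (hA : A.Nonempty) : ((Cy A).card : ℚ) = (A.card - 1).factorial := by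
  induction A using Finset.strongInduction with
  | H A ih =>
    have h := Wt_rec (fun _ => (1 : ℚ)) A
    simp only [Wt_one, one_mul] at h
    rw [← Finset.sum_erase_add _ _ (Finset.mem_powerset_self A)] at h
    have h2 : ∀ γ ∈ A.powerset.erase A,
        (γ.card : ℚ) * ((Cy γ).card * ((A \ γ).card.factorial : ℚ))
          = (fun k : ℕ => if k = 0 then (0:ℚ) else k.factorial * (A.card - k).factorial) γ.card := by
      intro γ hγ
      rw [Finset.mem_erase, Finset.mem_powerset] at hγ
      rcases Finset.eq_empty_or_nonempty γ with rfl | hne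
      · simp
      · rw [ih γ (Finset.ssubset_iff_subset_ne.2 ⟨hγ.2, hγ.1⟩) hne,
          Finset.card_sdiff_of_subset hγ.2]
        have hp := hne.card_pos
        simp only [hp.ne', if_false]
        rw [← mul_assoc, ← Nat.cast_mul, Nat.mul_factorial_pred hp.ne']
    have hp := hA.card_pos
    rw [Finset.sum_congr rfl h2] at h
    have h3 : ∑ γ ∈ A.powerset.erase A,
        (fun k : ℕ => if k = 0 then (0:ℚ) else k.factorial * (A.card - k).factorial) γ.card
        = A.card * (A.card.factorial : ℚ) - A.card.factorial := by
      rw [Finset.sum_erase_eq_sub (Finset.mem_powerset_self A), Finset.sum_powerset_apply_card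
        (fun k : ℕ => if k = 0 then (0:ℚ) else k.factorial * (A.card - k).factorial)]
      have : ∀ m ∈ Finset.range (A.card + 1), A.card.choose m •
          (fun k : ℕ => if k = 0 then (0:ℚ) else k.factorial * (A.card - k).factorial) m
          = if m = 0 then (0:ℚ) else A.card.factorial := by
        intro m hm
        rw [Finset.mem_range] at hm
        by_cases h0 : m = 0
        · simp [h0]
        · simp only [h0, if_false, nsmul_eq_mul]
          rw [← Nat.choose_mul_factorial_mul_factorial (show m ≤ A.card by omega)]
          push_cast; ring
      rw [Finset.sum_congr rfl this, Finset.sum_range_succ']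
      simp [hp.ne']
    rw [h3] at h
    simp only [Finset.sdiff_self, Finset.card_empty, Nat.factorial_zero, Nat.cast_one, mul_one] at h
    have h4 : (A.card : ℚ) * (Cy A).card = A.card.factorial := by linarith
    rw [← Nat.mul_factorial_pred hp.ne', Nat.cast_mul] at h4
    exact mul_left_cancel₀ (by exact_mod_cast hp.ne') h4

end Comb

/-- coefficients of `exp (∑ w_k z^k / k)`. -/
noncomputable def gco {R : Type} [Field R] (w : ℕ → R) : ℕ → R
  | 0 => 1
  | (s + 1) => (∑ k : Fin (s + 1), w (k + 1) * gco w (s - k)) / ((s : R) + 1)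
decreasing_by omega

section Gco
variable {R : Type} [Field R] [CharZero R]

lemma gco_zero (w : ℕ → R) : gco w 0 = 1 := by rw [gco]

lemma gco_succ (w : ℕ → R) (s : ℕ) :
    ((s : R) + 1) * gco w (s + 1) = ∑ k ∈ Finset.range (s + 1), w (k + 1) * gco w (s - k) := by
  rw [gco, mul_div_cancel₀ _ (by exact_mod_cast Nat.succ_ne_zero s),
    Finset.sum_range (fun k => w (k + 1) * gco w (s - k))]

variable {α : Type} [Fintype α] [DecidableEq α]

lemma Wt_eq (w : ℕ → R) (A : Finset α) : Wt w A = A.card.factorial * gco w A.card := by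
  induction A using Finset.strongInduction with
  | H A ih =>
    rcases Finset.eq_empty_or_nonempty A with rfl | hA
    · have h1 : Pm (∅ : Finset α) = {id} := by
        ext f
        simp only [Pm, Finset.mem_filter, Finset.mem_univ, true_and, Finset.mem_singleton]
        constructor
        · intro h; funext x; exact h.2 x (by simp)
        · rintro rfl; simp
      have h2 : (cyc (id : α → α)).filter (· ⊆ ∅) = ∅ := by
        ext γ
        simp only [Finset.mem_filter, mem_cyc, Finset.subset_empty]
        constructor
        · rintro ⟨h, rfl⟩; exact absurd h.1 (by simp)
        · intro h; simp at h
      simp only [Wt, wt, h1, Finset.sum_singleton, h2]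
      simp [gco_zero]
    · have h := Wt_rec w A
      have hp := hA.card_pos
      have h2 : ∀ γ ∈ A.powerset, (γ.card : R) * (w γ.card * ((Cy γ).card * Wt w (A \ γ)))
          = (fun k : ℕ => if k = 0 then (0:R) else k.factorial * (A.card - k).factorial *
              (w k * gco w (A.card - k))) γ.card := by
        intro γ hγ
        rw [Finset.mem_powerset] at hγ
        rcases Finset.eq_empty_or_nonempty γ with rfl | hne
        · simp
        · have hq := hne.card_pos
          have hc : ((Cy γ).card : R) = (γ.card - 1).factorial := by
            exact_mod_cast card_Cy γ hne
          rw [ih (A \ γ) (Finset.sdiff_ssubset hγ hne), hc, Finset.card_sdiff_of_subset hγ]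
          simp only [hq.ne', if_false]
          conv_rhs => rw [← Nat.mul_factorial_pred hq.ne', Nat.cast_mul]
          ring
      rw [Finset.sum_congr rfl h2, Finset.sum_powerset_apply_card
        (fun k : ℕ => if k = 0 then (0:R) else k.factorial * (A.card - k).factorial *
              (w k * gco w (A.card - k)))] at h
      have : ∀ m ∈ Finset.range (A.card + 1), A.card.choose m •
          (fun k : ℕ => if k = 0 then (0:R) else k.factorial * (A.card - k).factorial *
              (w k * gco w (A.card - k))) m
          = if m = 0 then (0:R) else A.card.factorial * (w m * gco w (A.card - m)) := by
        intro m hm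
        rw [Finset.mem_range] at hm
        by_cases h0 : m = 0
        · simp [h0]
        · simp only [h0, if_false, nsmul_eq_mul]
          rw [← Nat.choose_mul_factorial_mul_factorial (show m ≤ A.card by omega)]
          push_cast; ring
      rw [Finset.sum_congr rfl this, Finset.sum_range_succ'] at h
      simp only [if_true, add_zero, Nat.succ_ne_zero, if_false] at h
      rw [← Finset.mul_sum] at h
      obtain ⟨s, hs⟩ : ∃ s, A.card = s + 1 := ⟨A.card - 1, by omega⟩
      rw [hs] at h ⊢
      simp only [Nat.add_sub_add_right] at h
      rw [← gco_succ] at h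
      have hne : ((s : R) + 1) ≠ 0 := by exact_mod_cast Nat.succ_ne_zero s
      apply mul_left_cancel₀ hne
      push_cast at h
      rw [h]; ring

lemma prod_cyc_eq (w : ℕ → R) (f : α → α) :
    ∏ γ ∈ cyc f, (1 + w γ.card)
      = ∑ A ∈ Finset.univ.filter (fun A : Finset α => A.image f = A), wt w A f := by
  rw [Finset.prod_one_add]
  have hsub : ∀ S ∈ (cyc f).powerset, ∀ γ, γ ∈ cyc f → γ ⊆ S.biUnion id → γ ∈ S := by
    intro S hS γ hγ hsub
    rw [Finset.mem_powerset] at hS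
    obtain ⟨x, hx⟩ := (mem_cyc.1 hγ).1
    obtain ⟨δ, hδ, hxδ⟩ := Finset.mem_biUnion.1 (hsub hx)
    rwa [(mem_cyc.1 hγ).eq_of_mem (mem_cyc.1 (hS hδ)) hx hxδ]
  refine Finset.sum_bij' (fun S _ => S.biUnion id) (fun A _ => (cyc f).filter (· ⊆ A)) ?_ ?_ ?_ ?_ ?_
  · intro S hS
    rw [Finset.mem_powerset] at hS
    simp only [Finset.mem_filter, Finset.mem_univ, true_and]
    rw [Finset.biUnion_image]
    refine Finset.biUnion_congr rfl fun γ hγ => ?_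
    exact (mem_cyc.1 (hS hγ)).image
  · intro A _
    simp
  · intro S hS
    ext γ
    simp only [Finset.mem_filter]
    constructor
    · rintro ⟨h1, h2⟩; exact hsub S hS γ h1 h2
    · intro h; exact ⟨Finset.mem_powerset.1 hS h, Finset.subset_biUnion_of_mem id h⟩
  · intro A hA
    simp only [Finset.mem_filter, Finset.mem_univ, true_and] at hA
    ext x
    simp only [Finset.mem_biUnion, Finset.mem_filter, mem_cyc, id]
    constructor
    · rintro ⟨γ, ⟨_, h3⟩, h2⟩; exact h3 h2
    · intro hx
      obtain ⟨γ, h1, h2, h3⟩ := exists_cyc hA hx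
      exact ⟨γ, ⟨h1, h3⟩, h2⟩
  · intro S hS
    unfold wt
    refine Finset.prod_congr ?_ fun _ _ => rfl
    ext γ
    simp only [Finset.mem_filter]
    constructor
    · intro h; exact ⟨Finset.mem_powerset.1 hS h, Finset.subset_biUnion_of_mem id h⟩
    · rintro ⟨h1, h2⟩; exact hsub S hS γ h1 h2

lemma card_Off (A : Finset α) :
    (Off A).card = Fintype.card α ^ (Fintype.card α - A.card) := by
  have : Off A = Fintype.piFinset (fun x => if x ∈ A then {x} else Finset.univ) := by
    ext f
    simp only [Off, Finset.mem_filter, Finset.mem_univ, true_and, Fintype.mem_piFinset]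
    refine forall_congr' fun x => ?_
    by_cases hx : x ∈ A <;> simp [hx]
  rw [this, Fintype.card_piFinset]
  have h2 : ∀ x, (if x ∈ A then ({x} : Finset α) else Finset.univ).card
      = if x ∈ A then 1 else Fintype.card α := by
    intro x; split_ifs <;> simp
  simp only [h2]
  rw [Finset.prod_ite]
  simp only [Finset.prod_const_one, one_mul, Finset.prod_const]
  congr 1
  rw [← Finset.card_compl]
  congr 1
  ext x; simp

lemma sum_inv (w : ℕ → R) (A : Finset α) :
    ∑ f ∈ Finset.univ.filter (fun f : α → α => A.image f = A), wt w A f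
      = (Off A).card * Wt w A := by
  have : ((Off A).card : R) * Wt w A = ∑ p ∈ Off A ×ˢ Pm A, wt w A p.2 := by
    rw [Finset.sum_product]; simp [Wt]
  rw [this]
  refine Finset.sum_bij' (fun f _ => (mrg A id f, mrg A f id)) (fun p _ => mrg A p.2 p.1)
    ?_ ?_ ?_ ?_ ?_
  · intro f hf
    simp only [Finset.mem_filter, Finset.mem_univ, true_and] at hf
    simp only [Finset.mem_product, Off, Pm, Finset.mem_filter, Finset.mem_univ, true_and]
    refine ⟨fun x hx => by simp [mrg, hx], ?_, fun x hx => by simp [mrg, hx]⟩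
    conv_rhs => rw [← hf]
    apply Finset.image_congr
    intro x hx
    simp only [Finset.mem_coe] at hx
    simp [mrg, hx]
  · rintro ⟨f1, f2⟩ hp
    simp only [Finset.mem_product, Off, Pm, Finset.mem_filter, Finset.mem_univ, true_and] at hp ⊢
    conv_rhs => rw [← hp.2.1]
    apply Finset.image_congr
    intro x hx
    simp only [Finset.mem_coe] at hx
    simp [mrg, hx]
  · intro f hf
    funext x
    by_cases h1 : x ∈ A <;> simp [mrg, h1]
  · rintro ⟨f1, f2⟩ hp
    simp only [Finset.mem_product, Off, Pm, Finset.mem_filter, Finset.mem_univ, true_and] at hp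
    refine Prod.ext ?_ ?_
    · funext x
      by_cases h1 : x ∈ A
      · simp [mrg, h1, hp.1 x h1]
      · simp [mrg, h1]
    · funext x
      by_cases h1 : x ∈ A
      · simp [mrg, h1]
      · simp [mrg, h1, hp.2.2 x h1]
  · intro f hf
    apply wt_congr
    intro x hx
    simp [mrg, hx]

/-- `(n)_s / n^s`. -/
noncomputable def av (n s : ℕ) : ℝ := (n.descFactorial s : ℝ) / (n : ℝ) ^ s

theorem main_identity [Algebra ℝ R] (w : ℕ → R) (n : ℕ) :
    ∑ f : Fin n → Fin n, ∏ γ ∈ cyc f, (1 + w γ.card)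
      = (n : R) ^ n * ∑ s ∈ Finset.range (n + 1), algebraMap ℝ R (av n s) * gco w s := by
  simp only [prod_cyc_eq]
  have h0 : ∑ f : Fin n → Fin n,
      ∑ A ∈ Finset.univ.filter (fun A : Finset (Fin n) => A.image f = A), wt w A f
      = ∑ A ∈ (Finset.univ : Finset (Fin n)).powerset,
        (fun k : ℕ => (n : R) ^ (n - k) * (k.factorial * gco w k)) A.card := by
    simp only [Finset.sum_filter]
    rw [Finset.sum_comm]
    simp only [← Finset.sum_filter]
    rw [Finset.powerset_univ]
    refine Finset.sum_congr rfl fun A _ => ?_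
    rw [sum_inv, card_Off, Wt_eq]
    simp
  rw [h0, Finset.sum_powerset_apply_card
    (fun k : ℕ => (n : R) ^ (n - k) * (k.factorial * gco w k)), Finset.mul_sum]
  simp only [Finset.card_univ, Fintype.card_fin]
  refine Finset.sum_congr rfl fun s hs => ?_
  rw [Finset.mem_range] at hs
  rcases Nat.eq_zero_or_pos n with rfl | hn
  · have : s = 0 := by omega
    subst this
    simp [av]
  rw [av, map_div₀, map_pow, map_natCast, map_natCast, Nat.descFactorial_eq_factorial_mul_choose]
  have hn' : (n : R) ≠ 0 := by exact_mod_cast hn.ne'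
  have : (n : R) ^ n = (n : R) ^ (n - s) * (n : R) ^ s := by
    rw [← pow_add]; congr 1; omega
  rw [this, nsmul_eq_mul]
  field_simp
  push_cast
  ring

end Gco

section Tlcm

lemma IsCyc.iterate_eq_iff {α : Type} [Fintype α] [DecidableEq α] {f : α → α} {γ : Finset α}
    (h : IsCyc f γ) {x : α} (hx : x ∈ γ) (t : ℕ) : f^[t] x = x ↔ γ.card ∣ t := by
  have hper : x ∈ periodicPts f := by
    obtain ⟨i, hi⟩ := h.2.2 (f x) (h.2.1 x hx) x hx
    exact ⟨i + 1, Nat.succ_pos i, by rw [IsPeriodicPt, IsFixedPt, iterate_succ_apply, hi]⟩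
  have hpos := minimalPeriod_pos_of_mem_periodicPts hper
  have hcard : γ.card = minimalPeriod f x := by
    have : γ = (Finset.range (minimalPeriod f x)).image (fun i => f^[i] x) := by
      ext y
      simp only [Finset.mem_image, Finset.mem_range]
      constructor
      · intro hy
        obtain ⟨i, rfl⟩ := h.2.2 x hx y hy
        exact ⟨i % minimalPeriod f x, Nat.mod_lt _ hpos, iterate_mod_minimalPeriod_eq⟩
      · rintro ⟨i, _, rfl⟩; exact h.iterate_mem hx i
    conv_lhs => rw [this]
    rw [Finset.card_image_of_injOn, Finset.card_range]
    have := iterate_injOn_Iio_minimalPeriod (f := f) (x := x)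
    intro i hi j hj hij
    exact this (by simpa using hi) (by simpa using hj) hij
  rw [hcard]
  exact isPeriodicPt_iff_minimalPeriod_dvd

lemma periodic_iterate {n : ℕ} (f : Fin n → Fin n) (x : Fin n) {m : ℕ} (hm : n ≤ m) :
    ∃ p, 0 < p ∧ f^[p] (f^[m] x) = f^[m] x := by
  obtain ⟨i, j, hij, he⟩ := Fintype.exists_ne_map_eq_of_card_lt
    (fun i : Fin (n + 1) => f^[(i : ℕ)] x) (by simp)
  wlog hlt : i < j generalizing i j
  · exact this j i hij.symm he.symm (lt_of_le_of_ne (not_lt.1 hlt) hij.symm)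
  have h1 : (i : ℕ) < j := hlt
  have h2 := j.2
  refine ⟨j - i, by omega, ?_⟩
  have e1 : f^[m] x = f^[m - i] (f^[(i : ℕ)] x) := by
    rw [← iterate_add_apply]; congr 2; omega
  have e2 : f^[(j : ℕ) - i] (f^[m] x) = f^[m - i] (f^[(j : ℕ)] x) := by
    rw [← iterate_add_apply, show (j : ℕ) - i + m = m - i + j by omega, iterate_add_apply]
  rw [e2, ← he, e1]

noncomputable def lcmc {n : ℕ} (f : Fin n → Fin n) : ℕ := (cyc f).lcm Finset.card

lemma card_pos_of_cyc {n : ℕ} {f : Fin n → Fin n} {γ : Finset (Fin n)} (h : γ ∈ cyc f) :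
    0 < γ.card := (mem_cyc.1 h).1.card_pos

lemma card_le_of_cyc {n : ℕ} (γ : Finset (Fin n)) : γ.card ≤ n := by
  simpa using Finset.card_le_univ γ

lemma lcmc_pos {n : ℕ} (f : Fin n → Fin n) : 0 < lcmc f := by
  rw [Nat.pos_iff_ne_zero, lcmc, Ne, Finset.lcm_eq_zero_iff]
  rintro ⟨γ, h, h0⟩
  exact (card_pos_of_cyc (by exact_mod_cast h)).ne' h0

lemma T_eq {n : ℕ} (f : Fin n → Fin n) : T f = lcmc f := by
  apply le_antisymm
  · apply Nat.sInf_le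
    refine ⟨lcmc_pos f, fun m hm => ?_⟩
    funext x
    have hc := isCyc_orbit (periodic_iterate f x hm)
    rw [add_comm, iterate_add_apply]
    rw [hc.iterate_eq_iff (by simp; exact ⟨0, rfl⟩)]
    exact Finset.dvd_lcm (mem_cyc.2 hc)
  · apply le_csInf
    · refine ⟨lcmc f, lcmc_pos f, fun m hm => ?_⟩
      funext x
      have hc := isCyc_orbit (periodic_iterate f x hm)
      rw [add_comm, iterate_add_apply]
      rw [hc.iterate_eq_iff (by simp; exact ⟨0, rfl⟩)]
      exact Finset.dvd_lcm (mem_cyc.2 hc)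
    · rintro t ⟨ht, h⟩
      apply Nat.le_of_dvd ht
      apply Finset.lcm_dvd
      intro γ hγ
      have hc := mem_cyc.1 hγ
      obtain ⟨x, hx⟩ := hc.1
      rw [← hc.iterate_eq_iff (hc.iterate_mem hx n) t, ← iterate_add_apply, add_comm, h n le_rfl]

/-- number of cycles with length divisible by `q` -/
noncomputable def Dq {n : ℕ} (q : ℕ) (f : Fin n → Fin n) : ℕ :=
  ((cyc f).filter (fun γ => q ∣ γ.card)).card

lemma logT_le {n : ℕ} (f : Fin n → Fin n) :
    Real.log (T f) ≤ ∑ γ ∈ cyc f, Real.log γ.card := by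
  rw [T_eq, ← Real.log_prod (fun γ h => by exact_mod_cast (card_pos_of_cyc h).ne'), ← Nat.cast_prod]
  apply Real.log_le_log (by exact_mod_cast lcmc_pos f)
  norm_cast
  apply Nat.le_of_dvd (Finset.prod_pos fun γ h => card_pos_of_cyc h)
  apply Finset.lcm_dvd
  intro γ h
  exact Finset.dvd_prod_of_mem _ h

lemma le_logT {n : ℕ} (f : Fin n → Fin n) :
    ∑ γ ∈ cyc f, Real.log γ.card - Real.log (T f)
      ≤ ∑ q ∈ Finset.Icc 1 n, ArithmeticFunction.vonMangoldt q * ((Dq q f - 1 : ℕ) : ℝ) := by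
  have h1 : ∑ γ ∈ cyc f, Real.log γ.card
      = ∑ q ∈ Finset.Icc 1 n, ArithmeticFunction.vonMangoldt q * (Dq q f : ℝ) := by
    have : ∀ γ ∈ cyc f, Real.log γ.card
        = ∑ q ∈ Finset.Icc 1 n, if q ∣ γ.card then ArithmeticFunction.vonMangoldt q else 0 := by
      intro γ hγ
      rw [← ArithmeticFunction.vonMangoldt_sum, ← Finset.sum_filter]
      refine Finset.sum_congr ?_ fun _ _ => rfl
      ext q
      have hp := card_pos_of_cyc hγ
      have hl := card_le_of_cyc γ
      simp only [Nat.mem_divisors, Finset.mem_filter, Finset.mem_Icc]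
      constructor
      · rintro ⟨h, _⟩
        exact ⟨⟨Nat.pos_of_dvd_of_pos h hp, (Nat.le_of_dvd hp h).trans hl⟩, h⟩
      · rintro ⟨_, h⟩; exact ⟨h, hp.ne'⟩
    rw [Finset.sum_congr rfl this, Finset.sum_comm]
    refine Finset.sum_congr rfl fun q _ => ?_
    rw [← Finset.sum_filter, Finset.sum_const, nsmul_eq_mul, Dq, mul_comm]
  have h2 : ∑ q ∈ Finset.Icc 1 n, ArithmeticFunction.vonMangoldt q * (if 1 ≤ Dq q f then (1:ℝ) else 0)
      ≤ Real.log (T f) := by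
    rw [T_eq, ← ArithmeticFunction.vonMangoldt_sum]
    simp only [mul_ite, mul_one, mul_zero]
    rw [← Finset.sum_filter]
    apply Finset.sum_le_sum_of_subset_of_nonneg
    · intro q hq
      simp only [Finset.mem_filter, Finset.mem_Icc] at hq
      obtain ⟨γ, hγ⟩ := Finset.card_pos.1 hq.2
      rw [Finset.mem_filter] at hγ
      rw [Nat.mem_divisors]
      exact ⟨hγ.2.trans (Finset.dvd_lcm hγ.1), (lcmc_pos f).ne'⟩
    · intro q _ _; exact ArithmeticFunction.vonMangoldt_nonneg
  rw [h1]
  refine (sub_le_sub_left h2 _).trans ?_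
  rw [← Finset.sum_sub_distrib]
  refine Finset.sum_le_sum fun q _ => le_of_eq ?_
  rw [← mul_sub]
  congr 1
  split_ifs with h
  · rw [Nat.cast_sub h]; simp
  · have : Dq q f = 0 := by omega
    simp [this]

end Tlcm

section GcoAnalysis

lemma gco_congr {R : Type} [Field R] [CharZero R] {w w' : ℕ → R} (s : ℕ)
    (h : ∀ k, 1 ≤ k → k ≤ s → w k = w' k) : gco w s = gco w' s := by
  induction s using Nat.strong_induction_on with
  | _ s ih =>
    rcases s with _ | s
    · rw [gco_zero, gco_zero]
    · have hne : ((s : R) + 1) ≠ 0 := by exact_mod_cast Nat.succ_ne_zero s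
      apply mul_left_cancel₀ hne
      rw [gco_succ, gco_succ]
      refine Finset.sum_congr rfl fun k hk => ?_
      rw [Finset.mem_range] at hk
      rw [h (k + 1) (by omega) (by omega), ih (s - k) (by omega) fun j h1 h2 => h j h1 (by omega)]

lemma gco_add_one {R : Type} [Field R] [CharZero R] (w : ℕ → R) (m : ℕ) :
    gco (fun k => 1 + w k) m = ∑ s ∈ Finset.range (m + 1), gco w s := by
  set H : ℕ → R := fun m => ∑ s ∈ Finset.range (m + 1), gco w s with hH
  have hHs : ∀ m, H (m + 1) = H m + gco w (m + 1) := fun m => by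
    simp only [hH]; rw [Finset.sum_range_succ]
  have hH0 : H 0 = 1 := by simp [hH, gco_zero]
  have hS : ∀ m, ∑ k ∈ Finset.range (m + 1), w (k + 1) * H (m - k)
      + ∑ k ∈ Finset.range (m + 1), H (m - k) = ((m : R) + 1) * H (m + 1) := by
    intro m
    have hrefl : ∀ m, ∑ k ∈ Finset.range (m + 1), H (m - k) = ∑ k ∈ Finset.range (m + 1), H k :=
      fun m => by
        have := Finset.sum_range_reflect H (m + 1)
        simpa using this
    rw [hrefl]
    induction m with
    | zero =>
      have := gco_succ w 0
      simp [gco_zero] at this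
      simp [hHs, hH0, this]; ring
    | succ m ih =>
      rw [Finset.sum_range_succ (fun k => w (k + 1) * H (m + 1 - k)), Finset.sum_range_succ H]
      have h1 : ∀ k ∈ Finset.range (m + 1), w (k + 1) * H (m + 1 - k)
          = w (k + 1) * H (m - k) + w (k + 1) * gco w (m + 1 - k) := by
        intro k hk
        rw [Finset.mem_range] at hk
        rw [show m + 1 - k = (m - k) + 1 by omega, hHs]; ring
      rw [Finset.sum_congr rfl h1, Finset.sum_add_distrib]
      have h2 := gco_succ w (m + 1)
      rw [Finset.sum_range_succ] at h2
      simp only [Nat.sub_self, gco_zero, hH0] at h2 ⊢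
      rw [hHs (m + 1)]
      push_cast at h2 ⊢
      linear_combination ih - h2
  change _ = H m
  induction m using Nat.strong_induction_on with
  | _ s ih =>
    rcases s with _ | s
    · rw [gco_zero, hH0]
    · have hne : ((s : R) + 1) ≠ 0 := by exact_mod_cast Nat.succ_ne_zero s
      apply mul_left_cancel₀ hne
      rw [gco_succ, ← hS, ← Finset.sum_add_distrib]
      refine Finset.sum_congr rfl fun k hk => ?_
      rw [ih (s - k) (by omega)]; ring

lemma gco_nonneg {w : ℕ → ℝ} (hw : ∀ k, 0 ≤ w k) (s : ℕ) : 0 ≤ gco w s := by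
  induction s using Nat.strong_induction_on with
  | _ s ih =>
    rcases s with _ | s
    · rw [gco_zero]; exact zero_le_one
    · rw [gco]
      exact div_nonneg (Finset.sum_nonneg fun k _ => mul_nonneg (hw _) (ih _ (by omega)))
        (by positivity)

lemma norm_gco_le {w : ℕ → ℂ} {v : ℕ → ℝ} (h : ∀ k, ‖w k‖ ≤ v k) (s : ℕ) :
    ‖gco w s‖ ≤ gco v s := by
  have hv : ∀ k, 0 ≤ v k := fun k => (norm_nonneg _).trans (h k)
  induction s using Nat.strong_induction_on with
  | _ s ih =>
    rcases s with _ | s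
    · rw [gco_zero, gco_zero]; simp
    · rw [gco, gco, norm_div]
      have : ‖(s : ℂ) + 1‖ = (s : ℝ) + 1 := by
        rw [← Nat.cast_succ, Complex.norm_natCast]; simp
      rw [this]
      gcongr
      refine (norm_sum_le _ _).trans (Finset.sum_le_sum fun k _ => ?_)
      rw [norm_mul]
      exact mul_le_mul (h _) (ih _ (by omega)) (norm_nonneg _) (hv _)

lemma gco_one (m : ℕ) : gco (fun _ => (1 : ℝ)) m = 1 := by
  have h0 : ∀ s, gco (fun _ => (0 : ℝ)) (s + 1) = 0 := by
    intro s; rw [gco]; simp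
  have := gco_add_one (fun _ => (0 : ℝ)) m
  simp only [add_zero] at this
  rw [this, Finset.sum_range_succ']
  simp [h0, gco_zero]

lemma gco_mul_pow (w : ℕ → ℝ) (z : ℝ) (s : ℕ) : gco (fun k => w k * z ^ k) s = gco w s * z ^ s := by
  induction s using Nat.strong_induction_on with
  | _ s ih =>
    rcases s with _ | s
    · rw [gco_zero, gco_zero]; simp
    · have hne : ((s : ℝ) + 1) ≠ 0 := by positivity
      apply mul_left_cancel₀ hne
      rw [gco_succ, ← mul_assoc, gco_succ, Finset.sum_mul]
      refine Finset.sum_congr rfl fun k hk => ?_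
      rw [Finset.mem_range] at hk
      rw [ih (s - k) (by omega), show s + 1 = (k + 1) + (s - k) by omega, pow_add]; ring

lemma gco_ofReal (w : ℕ → ℝ) (s : ℕ) : gco (fun k => (w k : ℂ)) s = ((gco w s : ℝ) : ℂ) := by
  induction s using Nat.strong_induction_on with
  | _ s ih =>
    rcases s with _ | s
    · rw [gco_zero, gco_zero]; simp
    · rw [gco, gco]
      push_cast
      congr 1
      refine Finset.sum_congr rfl fun k _ => ?_
      rw [ih _ (by omega)]

lemma hasSum_gco (w : ℕ → ℂ) (K : ℕ) (hw : ∀ k, K < k → w k = 0) :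
    HasSum (gco w) (Complex.exp (∑ k ∈ Finset.range K, w (k + 1) / ((k : ℂ) + 1))) := by
  set F : ℂ → ℂ := fun z => Complex.exp (∑ k ∈ Finset.range K, w (k + 1) / ((k : ℂ) + 1) * z ^ (k + 1))
    with hF
  set p : ℂ → ℂ := fun z => ∑ k ∈ Finset.range K, w (k + 1) * z ^ k with hp
  have hFd : ∀ z, HasDerivAt F (p z * F z) z := by
    intro z
    have h1 : HasDerivAt (fun z : ℂ => ∑ k ∈ Finset.range K, w (k + 1) / ((k : ℂ) + 1) * z ^ (k + 1))
        (p z) z := by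
      apply HasDerivAt.fun_sum
      intro k _
      have := (hasDerivAt_pow (k + 1) z).const_mul (w (k + 1) / ((k : ℂ) + 1))
      refine this.congr_deriv ?_
      have hne : ((k : ℂ) + 1) ≠ 0 := by exact_mod_cast Nat.succ_ne_zero k
      rw [Nat.add_sub_cancel]
      push_cast
      field_simp
    have := h1.cexp
    rw [mul_comm]; exact this
  have hdiff : Differentiable ℂ F := fun z => (hFd z).differentiableAt
  have hderiv : deriv F = fun z => p z * F z := funext fun z => (hFd z).deriv
  have hFc : ContDiff ℂ ⊤ F := hdiff.contDiff
  have hpc : ContDiff ℂ ⊤ p := by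
    apply ContDiff.sum
    intro k _
    exact contDiff_const.mul (contDiff_id.pow k)
  have hpi : ∀ i, iteratedDeriv i p 0 = i.factorial * w (i + 1) := by
    intro i
    rw [hp, iteratedDeriv_fun_sum]
    · have : ∀ k ∈ Finset.range K, iteratedDeriv i (fun z : ℂ => w (k + 1) * z ^ k) 0
          = if i = k then (i.factorial : ℂ) * w (i + 1) else 0 := by
        intro k _
        rw [iteratedDeriv_const_mul_field, iteratedDeriv_fun_pow_zero]
        split_ifs with h1
        · subst h1; ring
        · simp
      rw [Finset.sum_congr rfl this, Finset.sum_ite_eq]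
      split_ifs with h
      · rfl
      · rw [Finset.mem_range, not_lt] at h
        rw [hw (i + 1) (by omega)]; simp
    · intro k _
      exact (contDiff_const.mul (contDiff_id.pow k)).contDiffAt
  have hco : ∀ s, iteratedDeriv s F 0 = s.factorial * gco w s := by
    intro s
    induction s using Nat.strong_induction_on with
    | _ s ih =>
      rcases s with _ | s
      · rw [gco_zero]; simp [hF]
      · rw [iteratedDeriv_succ', hderiv, iteratedDeriv_fun_mul (hpc.contDiffAt.of_le le_top) (hFc.contDiffAt.of_le le_top)]
        rw [Nat.factorial_succ, Nat.cast_mul, mul_comm ((s + 1 : ℕ) : ℂ), mul_assoc]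
        push_cast
        rw [gco_succ, Finset.mul_sum]
        refine Finset.sum_congr rfl fun k hk => ?_
        rw [Finset.mem_range] at hk
        rw [hpi, ih (s - k) (by omega), ← Nat.choose_mul_factorial_mul_factorial (show k ≤ s by omega)]
        push_cast; ring
  have := Complex.hasSum_taylorSeries_of_entire hdiff 0 1
  simp only [hco] at this
  have e : (fun n : ℕ => ((n.factorial : ℂ))⁻¹ • ((1 : ℂ) - 0) ^ n • ((n.factorial : ℂ) * gco w n))
      = gco w := by
    funext s
    have hs : (s.factorial : ℂ) ≠ 0 := by exact_mod_cast s.factorial_ne_zero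
    simp only [sub_zero, one_pow, one_smul, smul_eq_mul]
    field_simp
  rw [e] at this
  have e2 : F 1 = Complex.exp (∑ k ∈ Finset.range K, w (k + 1) / ((k : ℂ) + 1)) := by
    simp [hF]
  rw [e2] at this
  exact this

lemma sum_gco_le {w : ℕ → ℝ} (hw : ∀ k, 0 ≤ w k) (N : ℕ) :
    ∑ s ∈ Finset.range (N + 1), gco w s
      ≤ Real.exp (∑ k ∈ Finset.range N, w (k + 1) / ((k : ℝ) + 1)) := by
  set v : ℕ → ℝ := fun k => if k ≤ N then w k else 0 with hv
  have hv0 : ∀ k, 0 ≤ v k := fun k => by simp only [hv]; split_ifs <;> simp [hw]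
  have h1 := hasSum_gco (fun k => (v k : ℂ)) N (by
    intro k hk; simp [hv, not_le.2 hk])
  have h2 : HasSum (gco v) (Real.exp (∑ k ∈ Finset.range N, v (k + 1) / ((k : ℝ) + 1))) := by
    rw [← Complex.hasSum_ofReal]
    convert h1 using 1
    · funext s; rw [gco_ofReal]
    · push_cast; rfl
  have h3 : ∑ s ∈ Finset.range (N + 1), gco w s = ∑ s ∈ Finset.range (N + 1), gco v s := by
    refine Finset.sum_congr rfl fun s hs => gco_congr s fun k _ hk => ?_
    rw [Finset.mem_range] at hs
    simp only [hv]; rw [if_pos (by omega)]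
  have h4 : ∑ k ∈ Finset.range N, w (k + 1) / ((k : ℝ) + 1)
      = ∑ k ∈ Finset.range N, v (k + 1) / ((k : ℝ) + 1) := by
    refine Finset.sum_congr rfl fun k hk => ?_
    rw [Finset.mem_range] at hk
    simp only [hv]; rw [if_pos (by omega)]
  rw [h3, h4]
  exact sum_le_hasSum _ (fun s _ => gco_nonneg hv0 s) h2

lemma av_zero (n : ℕ) : av n 0 = 1 := by simp [av]

lemma av_nonneg (n s : ℕ) : 0 ≤ av n s := by unfold av; positivity

lemma av_succ {n : ℕ} (hn : 0 < n) (s : ℕ) (hs : s ≤ n) : av n (s + 1) = av n s * (1 - s / n) := by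
  unfold av
  have : (n : ℝ) ≠ 0 := by exact_mod_cast hn.ne'
  rw [Nat.descFactorial_succ, Nat.cast_mul, Nat.cast_sub hs, pow_succ]
  field_simp

lemma av_le_one {n : ℕ} (s : ℕ) : av n s ≤ 1 := by
  unfold av
  apply div_le_one_of_le₀ _ (by positivity)
  exact_mod_cast Nat.descFactorial_le_pow n s

lemma av_anti {n : ℕ} (hn : 0 < n) (s : ℕ) (hs : s ≤ n) : av n (s + 1) ≤ av n s := by
  rw [av_succ hn s hs]
  apply mul_le_of_le_one_right (av_nonneg n s)
  have : 0 ≤ (s : ℝ) / n := by positivity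
  linarith

lemma av_ge {n : ℕ} (hn : 0 < n) (s : ℕ) (hs : s ≤ n) : 1 - (s : ℝ) ^ 2 / n ≤ av n s := by
  induction s with
  | zero => simp [av_zero]
  | succ s ih =>
    have h1 := ih (by omega)
    rw [av_succ hn s (by omega)]
    have h2 : av n s * (s / n) ≤ s / n := mul_le_of_le_one_left (by positivity) (av_le_one s)
    have h3 : ((s + 1 : ℕ) : ℝ) ^ 2 / n = (s : ℝ) ^ 2 / n + 2 * (s / n) + 1 / n := by
      push_cast; ring
    have h4 : (0 : ℝ) ≤ 1 / n := by positivity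
    have h5 : (0 : ℝ) ≤ s / n := by positivity
    rw [h3, mul_sub, mul_one]
    linarith

lemma av_submul (n s t : ℕ) : av n (s + t) ≤ av n s * av n t := by
  unfold av
  rw [div_mul_div_comm, ← pow_add, ← Nat.cast_mul]
  gcongr
  induction t with
  | zero => simp
  | succ t ih =>
    rw [← add_assoc, Nat.descFactorial_succ, Nat.descFactorial_succ]
    calc (n - (s + t)) * n.descFactorial (s + t)
        ≤ (n - t) * (n.descFactorial s * n.descFactorial t) :=
          Nat.mul_le_mul (by omega) ih
      _ = _ := by ring

lemma av_mul_gco_le {w : ℕ → ℝ} (hw : ∀ k, 0 ≤ w k) (n s : ℕ) :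
    av n s * gco w s ≤ gco (fun k => av n k * w k) s := by
  induction s using Nat.strong_induction_on with
  | _ s ih =>
    rcases s with _ | s
    · rw [gco_zero, gco_zero]; simp [av_zero]
    · have hne : (0 : ℝ) < ((s : ℝ) + 1) := by positivity
      apply le_of_mul_le_mul_left _ hne
      rw [gco_succ, mul_left_comm, gco_succ, Finset.mul_sum]
      refine Finset.sum_le_sum fun k hk => ?_
      rw [Finset.mem_range] at hk
      have h1 : av n (s + 1) ≤ av n (k + 1) * av n (s - k) := by
        have := av_submul n (k + 1) (s - k)
        rwa [show k + 1 + (s - k) = s + 1 by omega] at this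
      have h2 := gco_nonneg hw (s - k)
      calc av n (s + 1) * (w (k + 1) * gco w (s - k))
          ≤ (av n (k + 1) * av n (s - k)) * (w (k + 1) * gco w (s - k)) :=
            mul_le_mul_of_nonneg_right h1 (mul_nonneg (hw _) h2)
        _ = av n (k + 1) * w (k + 1) * (av n (s - k) * gco w (s - k)) := by ring
        _ ≤ _ := mul_le_mul_of_nonneg_left (ih _ (by omega)) (mul_nonneg (av_nonneg _ _) (hw _))

/-- expectation under the uniform measure -/
noncomputable def Ex {n : ℕ} (X : (Fin n → Fin n) → ℝ) : ℝ := (∑ f, X f) / (n : ℝ) ^ n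

lemma Ex_prod_le {w : ℕ → ℝ} (hw : ∀ k, 0 ≤ w k) {n : ℕ} (hn : 0 < n) :
    Ex (fun f : Fin n → Fin n => ∏ γ ∈ cyc f, (1 + w γ.card))
      ≤ Real.exp (∑ k ∈ Finset.range n, av n (k + 1) * w (k + 1) / ((k : ℝ) + 1)) := by
  unfold Ex
  rw [main_identity w n]
  have : (n : ℝ) ^ n ≠ 0 := by positivity
  rw [mul_div_cancel_left₀ _ this]
  refine le_trans (Finset.sum_le_sum fun s _ => ?_)
    (sum_gco_le (w := fun k => av n k * w k) (fun k => mul_nonneg (av_nonneg n k) (hw k)) n)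
  exact av_mul_gco_le hw n s

lemma abel (a : ℕ → ℂ) (g : ℕ → ℂ) (n : ℕ) :
    ∑ s ∈ Finset.range (n + 1), a s * g s
      = a n * ∑ s ∈ Finset.range (n + 1), g s
        + ∑ m ∈ Finset.range n, (a m - a (m + 1)) * ∑ s ∈ Finset.range (m + 1), g s := by
  induction n with
  | zero => simp
  | succ n ih =>
    rw [Finset.sum_range_succ, ih, Finset.sum_range_succ (fun m => (a m - a (m + 1)) * _),
      Finset.sum_range_succ g (n + 1)]
    ring

lemma charfn_approx {n : ℕ} (hn : 0 < n) (u : ℕ → ℂ) (hu : ∀ k, ‖u k‖ ≤ 1) (K : ℕ)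
    (hK : ∀ k, K < k → u k = 1) (S : ℕ) (hS : S ≤ n) (z : ℝ) (hz : 1 ≤ z) (E : ℝ)
    (hE : ∑ k ∈ Finset.range K, 2 * z ^ (k + 1) / ((k : ℝ) + 1) ≤ E) :
    ‖(∑ f : Fin n → Fin n, ∏ γ ∈ cyc f, u γ.card) / (n : ℂ) ^ n
      - Complex.exp (∑ k ∈ Finset.range K, (u (k + 1) - 1) / ((k : ℂ) + 1))‖
      ≤ 2 * ((S : ℝ) ^ 2 / n) + Real.exp E / z ^ S := by
  set w : ℕ → ℂ := fun k => u k - 1 with hw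
  have hu' : u = fun k => 1 + w k := by funext k; simp [hw]
  have hw0 : ∀ k, K < k → w k = 0 := fun k hk => by simp [hw, hK k hk]
  set G := Complex.exp (∑ k ∈ Finset.range K, (u (k + 1) - 1) / ((k : ℂ) + 1)) with hG
  have hsum : HasSum (gco w) G := hasSum_gco w K hw0
  set H : ℕ → ℂ := fun m => ∑ s ∈ Finset.range (m + 1), gco w s with hH
  have hHt : Filter.Tendsto H Filter.atTop (nhds G) :=
    (hsum.tendsto_sum_nat).comp (Filter.tendsto_add_atTop_nat 1)
  have hH1 : ∀ m, ‖H m‖ ≤ 1 := by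
    intro m
    have h1 := norm_gco_le (w := u) (v := fun _ => 1) hu m
    rw [gco_one, hu', gco_add_one] at h1
    exact h1
  have hG1 : ‖G‖ ≤ 1 := le_of_tendsto hHt.norm (Filter.Eventually.of_forall hH1)
  set v : ℕ → ℝ := fun k => if k ≤ K then 2 else 0 with hv
  have hv0 : ∀ k, 0 ≤ v k := fun k => by simp only [hv]; split_ifs <;> norm_num
  have hwv : ∀ k, ‖w k‖ ≤ v k := by
    intro k
    simp only [hv]
    split_ifs with h
    · calc ‖u k - 1‖ ≤ ‖u k‖ + ‖(1:ℂ)‖ := norm_sub_le _ _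
        _ ≤ 2 := by rw [norm_one]; linarith [hu k]
    · rw [hw0 k (by omega)]; simp
  have hz0 : 0 < z := by linarith
  have htail : ∀ m, S ≤ m → ‖H m - G‖ ≤ Real.exp E / z ^ S := by
    intro m hm
    have hlim : Filter.Tendsto (fun N => ‖H m - H N‖) Filter.atTop (nhds ‖H m - G‖) :=
      (tendsto_const_nhds.sub hHt).norm
    refine le_of_tendsto hlim ?_
    filter_upwards [Filter.eventually_ge_atTop (max m K)] with N hN
    have hNm : m ≤ N := le_trans (le_max_left _ _) hN
    have hNK : K ≤ N := le_trans (le_max_right _ _) hN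
    have h1 : H m - H N = - ∑ s ∈ Finset.Ico (m + 1) (N + 1), gco w s := by
      rw [Finset.sum_Ico_eq_sub _ (by omega)]; simp only [hH]; ring
    rw [h1, norm_neg, le_div_iff₀ (by positivity)]
    calc ‖∑ s ∈ Finset.Ico (m + 1) (N + 1), gco w s‖ * z ^ S
        ≤ (∑ s ∈ Finset.Ico (m + 1) (N + 1), gco v s) * z ^ S := by
          gcongr
          exact (norm_sum_le _ _).trans (Finset.sum_le_sum fun s _ => norm_gco_le hwv s)
      _ = ∑ s ∈ Finset.Ico (m + 1) (N + 1), gco v s * z ^ S := Finset.sum_mul _ _ _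
      _ ≤ ∑ s ∈ Finset.Ico (m + 1) (N + 1), gco v s * z ^ s := by
          refine Finset.sum_le_sum fun s hs => ?_
          rw [Finset.mem_Ico] at hs
          exact mul_le_mul_of_nonneg_left (pow_le_pow_right₀ hz (by omega)) (gco_nonneg hv0 s)
      _ ≤ ∑ s ∈ Finset.range (N + 1), gco v s * z ^ s := by
          apply Finset.sum_le_sum_of_subset_of_nonneg
          · intro s hs; rw [Finset.mem_Ico] at hs; rw [Finset.mem_range]; omega
          · intro s _ _; exact mul_nonneg (gco_nonneg hv0 s) (by positivity)
      _ = ∑ s ∈ Finset.range (N + 1), gco (fun k => v k * z ^ k) s := by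
          simp only [gco_mul_pow]
      _ ≤ Real.exp (∑ k ∈ Finset.range N, v (k + 1) * z ^ (k + 1) / ((k : ℝ) + 1)) :=
          sum_gco_le (w := fun k => v k * z ^ k) (fun k => mul_nonneg (hv0 k) (by positivity)) N
      _ ≤ Real.exp E := by
          apply Real.exp_le_exp.2
          refine le_trans (le_of_eq ?_) hE
          rw [← Finset.sum_subset (Finset.range_subset_range.2 hNK)]
          · refine Finset.sum_congr rfl fun k hk => ?_
            rw [Finset.mem_range] at hk
            simp only [hv]; rw [if_pos (by omega)]
          · intro k _ hk
            rw [Finset.mem_range] at hk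
            simp only [hv]; rw [if_neg (by omega)]; simp
  set τ := Real.exp E / z ^ S with hτ
  have hτ0 : 0 ≤ τ := by positivity
  have hall : ∀ m, ‖H m - G‖ ≤ τ + (if m < S then 2 else 0) := by
    intro m
    split_ifs with h
    · calc ‖H m - G‖ ≤ ‖H m‖ + ‖G‖ := norm_sub_le _ _
        _ ≤ τ + 2 := by linarith [hH1 m, hG1]
    · simpa using htail m (by omega)
  have hid : (∑ f : Fin n → Fin n, ∏ γ ∈ cyc f, u γ.card) / (n : ℂ) ^ n
      = ∑ s ∈ Finset.range (n + 1), ((av n s : ℝ) : ℂ) * gco w s := by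
    have := main_identity w n
    rw [hu', this, mul_div_cancel_left₀ _ (by
      have : (n : ℂ) ≠ 0 := by exact_mod_cast hn.ne'
      positivity)]
    rfl
  have hdiff : (∑ s ∈ Finset.range (n + 1), ((av n s : ℝ) : ℂ) * gco w s) - G
      = ((av n n : ℝ) : ℂ) * (H n - G)
        + ∑ m ∈ Finset.range n, (((av n m - av n (m + 1) : ℝ)) : ℂ) * (H m - G) := by
    rw [abel]
    have ht : ∑ m ∈ Finset.range n, (av n m - av n (m + 1)) = 1 - av n n := by
      rw [Finset.sum_range_sub', av_zero]
    have ht' : ∑ m ∈ Finset.range n, (((av n m - av n (m + 1) : ℝ)) : ℂ) = 1 - ((av n n : ℝ) : ℂ) := by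
      rw [← Complex.ofReal_sum, ht]; simp
    simp only [mul_sub _ _ G, Finset.sum_sub_distrib, ← Finset.sum_mul, ht']
    simp only [hH]
    push_cast
    ring
  rw [hid, hdiff]
  have hp : ∀ m ∈ Finset.range n, 0 ≤ av n m - av n (m + 1) := fun m hm => by
    rw [Finset.mem_range] at hm
    linarith [av_anti hn m hm.le]
  calc _ ≤ ‖((av n n : ℝ) : ℂ) * (H n - G)‖
        + ∑ m ∈ Finset.range n, ‖(((av n m - av n (m + 1) : ℝ)) : ℂ) * (H m - G)‖ :=
        (norm_add_le _ _).trans (by gcongr; exact norm_sum_le _ _)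
    _ ≤ av n n * τ
        + ∑ m ∈ Finset.range n, (av n m - av n (m + 1)) * (τ + (if m < S then 2 else 0)) := by
        apply add_le_add
        · rw [norm_mul, Complex.norm_real, Real.norm_of_nonneg (av_nonneg _ _)]
          exact mul_le_mul_of_nonneg_left (htail n hS) (av_nonneg _ _)
        · refine Finset.sum_le_sum fun m hm => ?_
          rw [norm_mul, Complex.norm_real, Real.norm_of_nonneg (hp m hm)]
          exact mul_le_mul_of_nonneg_left (hall m) (hp m hm)
    _ = τ + 2 * (1 - av n S) := by
        simp only [mul_add, Finset.sum_add_distrib, ← Finset.sum_mul]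
        rw [Finset.sum_range_sub', av_zero]
        have : ∑ m ∈ Finset.range n, (av n m - av n (m + 1)) * (if m < S then (2:ℝ) else 0)
            = ∑ m ∈ Finset.range S, (av n m - av n (m + 1)) * 2 := by
          simp only [mul_ite, mul_zero]
          rw [← Finset.sum_filter]
          refine Finset.sum_congr ?_ fun _ _ => rfl
          ext m; simp only [Finset.mem_filter, Finset.mem_range]; omega
        rw [this, ← Finset.sum_mul, Finset.sum_range_sub', av_zero]
        ring
    _ ≤ _ := by
        have := av_ge hn S hS
        linarith

end GcoAnalysis

lemma Ex_mono {n : ℕ} {X Y : (Fin n → Fin n) → ℝ} (h : ∀ f, X f ≤ Y f) : Ex X ≤ Ex Y := by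
  unfold Ex
  exact div_le_div_of_nonneg_right (Finset.sum_le_sum fun f _ => h f) (by positivity)

lemma Ex_const_mul {n : ℕ} (a : ℝ) (X : (Fin n → Fin n) → ℝ) :
    Ex (fun f => a * X f) = a * Ex X := by
  unfold Ex
  rw [← Finset.mul_sum, mul_div_assoc]

lemma Ex_sum {n : ℕ} {ι : Type*} (s : Finset ι) (X : ι → (Fin n → Fin n) → ℝ) :
    Ex (fun f => ∑ i ∈ s, X i f) = ∑ i ∈ s, Ex (X i) := by
  unfold Ex
  rw [Finset.sum_comm, Finset.sum_div]

lemma Ex_add {n : ℕ} (X Y : (Fin n → Fin n) → ℝ) :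
    Ex (fun f => X f + Y f) = Ex X + Ex Y := by
  unfold Ex
  rw [Finset.sum_add_distrib, add_div]

/-- number of cycles with a property -/
noncomputable def Dp {n : ℕ} (P : ℕ → Prop) [DecidablePred P] (f : Fin n → Fin n) : ℕ :=
  ((cyc f).filter fun γ => P γ.card).card

lemma Ex_pow_le {n : ℕ} (hn : 0 < n) (P : ℕ → Prop) [DecidablePred P] (lam : ℝ) (hl : 0 < lam)
    (hs : ∑ k ∈ Finset.range n, (if P (k + 1) then av n (k + 1) / ((k : ℝ) + 1) else 0) ≤ lam) :
    Ex (fun f : Fin n → Fin n => (1 + 1 / lam) ^ (Dp P f)) ≤ Real.exp 1 := by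
  have h := Ex_prod_le (w := fun k => if P k then 1 / lam else 0)
    (fun k => by split_ifs <;> positivity) hn
  have e : (fun f : Fin n → Fin n => ∏ γ ∈ cyc f, (1 + (if P γ.card then 1 / lam else 0)))
      = fun f => (1 + 1 / lam) ^ (Dp P f) := by
    funext f
    unfold Dp
    rw [← Finset.prod_const, Finset.prod_filter]
    refine Finset.prod_congr rfl fun γ _ => ?_
    split_ifs <;> simp
  rw [e] at h
  refine h.trans (Real.exp_le_exp.2 ?_)
  calc ∑ k ∈ Finset.range n, av n (k + 1) * (if P (k + 1) then 1 / lam else 0) / ((k : ℝ) + 1)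
      = 1 / lam * ∑ k ∈ Finset.range n, (if P (k + 1) then av n (k + 1) / ((k : ℝ) + 1) else 0) := by
        rw [Finset.mul_sum]
        refine Finset.sum_congr rfl fun k _ => ?_
        split_ifs <;> ring
    _ ≤ 1 / lam * lam := by gcongr
    _ = 1 := by field_simp

lemma Ex_count_le {n : ℕ} (hn : 0 < n) (P : ℕ → Prop) [DecidablePred P] (lam : ℝ) (hl : 0 < lam)
    (hs : ∑ k ∈ Finset.range n, (if P (k + 1) then av n (k + 1) / ((k : ℝ) + 1) else 0) ≤ lam) :
    Ex (fun f : Fin n → Fin n => (Dp P f : ℝ)) ≤ lam * Real.exp 1 := by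
  refine le_trans ?_ (mul_le_mul_of_nonneg_left (Ex_pow_le hn P lam hl hs) hl.le)
  rw [← Ex_const_mul]
  refine Ex_mono fun f => ?_
  have h := one_add_mul_le_pow (a := 1 / lam) (by have : 0 < 1 / lam := by positivity
                                                  linarith) (Dp P f)
  calc (Dp P f : ℝ) = lam * ((Dp P f : ℝ) * (1 / lam)) := by field_simp
    _ ≤ _ := by gcongr; linarith

lemma Ex_count2_le {n : ℕ} (hn : 0 < n) (P : ℕ → Prop) [DecidablePred P] (lam : ℝ) (hl : 0 < lam)
    (hs : ∑ k ∈ Finset.range n, (if P (k + 1) then av n (k + 1) / ((k : ℝ) + 1) else 0) ≤ lam) :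
    Ex (fun f : Fin n → Fin n => ((Dp P f - 1 : ℕ) : ℝ)) ≤ lam ^ 2 * Real.exp 1 := by
  refine le_trans ?_ (mul_le_mul_of_nonneg_left (Ex_pow_le hn P lam hl hs) (sq_nonneg lam))
  rw [← Ex_const_mul]
  refine Ex_mono fun f => ?_
  have hp : 0 < 1 / lam := by positivity
  rcases Nat.eq_zero_or_pos (Dp P f) with h0 | h0
  · rw [h0]; simp; positivity
  · obtain ⟨d, hd⟩ : ∃ d, Dp P f = d + 1 := ⟨Dp P f - 1, by omega⟩
    rw [hd, Nat.add_sub_cancel, pow_succ (1 + 1 / lam)]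
    have h := one_add_mul_le_pow (a := 1 / lam) (by linarith) d
    calc (d : ℝ) = lam ^ 2 * (((d : ℝ) * (1 / lam)) * (1 / lam)) := by field_simp
      _ ≤ _ := by
        refine mul_le_mul_of_nonneg_left ?_ (sq_nonneg lam)
        exact mul_le_mul (by linarith) (by linarith) hp.le (by positivity)

lemma sum_dvd_le {n : ℕ} (hn : 0 < n) (q : ℕ) (hq : 0 < q) :
    ∑ k ∈ Finset.range n, (if q ∣ (k + 1) then av n (k + 1) / ((k : ℝ) + 1) else 0)
      ≤ (1 + Real.log n) / q := by
  have hq' : (0 : ℝ) < q := by exact_mod_cast hq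
  have h1 : ∑ j ∈ Finset.range n, 1 / ((j : ℝ) + 1) ≤ 1 + Real.log n := by
    have := harmonic_le_one_add_log n
    simpa [harmonic] using this
  calc ∑ k ∈ Finset.range n, (if q ∣ (k + 1) then av n (k + 1) / ((k : ℝ) + 1) else 0)
      ≤ ∑ k ∈ Finset.range n, (if q ∣ (k + 1) then 1 / ((k : ℝ) + 1) else 0) := by
        refine Finset.sum_le_sum fun k hk => ?_
        rw [Finset.mem_range] at hk
        split_ifs
        · gcongr
          exact av_le_one _
        · exact le_rfl
    _ = ∑ k ∈ (Finset.range n).filter (fun k => q ∣ (k + 1)), 1 / ((k : ℝ) + 1) :=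
        (Finset.sum_filter _ _).symm
    _ ≤ ∑ k ∈ (Finset.range n).image (fun j => q * (j + 1) - 1), 1 / ((k : ℝ) + 1) := by
        apply Finset.sum_le_sum_of_subset_of_nonneg
        · intro k hk
          rw [Finset.mem_filter, Finset.mem_range] at hk
          obtain ⟨hk, j, hj⟩ := hk
          rw [Finset.mem_image]
          rcases j with _ | j
          · omega
          · refine ⟨j, ?_, by omega⟩
            rw [Finset.mem_range]
            have : 1 * (j + 1) ≤ q * (j + 1) := Nat.mul_le_mul_right _ hq
            omega
        · intros; positivity
    _ = ∑ j ∈ Finset.range n, 1 / q * (1 / ((j : ℝ) + 1)) := by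
        rw [Finset.sum_image]
        · refine Finset.sum_congr rfl fun j _ => ?_
          have : 1 ≤ q * (j + 1) := Nat.mul_pos hq (Nat.succ_pos _)
          rw [Nat.cast_sub this]
          push_cast
          rw [sub_add_cancel]
          field_simp
        · intro a _ b _ hab
          have ha : 1 ≤ q * (a + 1) := Nat.mul_pos hq (Nat.succ_pos _)
          have hb : 1 ≤ q * (b + 1) := Nat.mul_pos hq (Nat.succ_pos _)
          have : q * (a + 1) = q * (b + 1) := by
            simp only at hab; omega
          have := Nat.eq_of_mul_eq_mul_left hq this
          omega
    _ = 1 / q * ∑ j ∈ Finset.range n, (1 / ((j : ℝ) + 1)) := (Finset.mul_sum _ _ _).symm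
    _ ≤ 1 / q * (1 + Real.log n) := by gcongr
    _ = _ := by ring

lemma Dq_eq {n : ℕ} (q : ℕ) (f : Fin n → Fin n) : Dq q f = Dp (fun k => q ∣ k) f := rfl

lemma Ex_Dq_le {n : ℕ} (hn : 0 < n) (q : ℕ) (hq : 0 < q) :
    Ex (fun f : Fin n → Fin n => ((Dq q f - 1 : ℕ) : ℝ))
      ≤ ((1 + Real.log n) / q) ^ ((5 : ℝ) / 4) * Real.exp 1 := by
  have hq' : (0 : ℝ) < q := by exact_mod_cast hq
  have hL : 0 ≤ Real.log n := Real.log_natCast_nonneg n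
  set lam := (1 + Real.log n) / q with hlam
  have hl : 0 < lam := by positivity
  have hs := sum_dvd_le hn q hq
  rcases le_total lam 1 with h | h
  · refine (Ex_count2_le hn (fun k => q ∣ k) lam hl hs).trans ?_
    gcongr
    rw [← Real.rpow_natCast lam 2]
    exact Real.rpow_le_rpow_of_exponent_ge hl h (by norm_num)
  · refine le_trans ?_ ((Ex_count_le hn (fun k => q ∣ k) lam hl hs).trans ?_)
    · refine Ex_mono fun f => ?_
      rw [Dq_eq]
      exact_mod_cast Nat.sub_le _ _
    · gcongr
      calc lam = lam ^ (1 : ℝ) := (Real.rpow_one _).symm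
        _ ≤ _ := Real.rpow_le_rpow_of_exponent_le h (by norm_num)

lemma Ex_logT_diff : ∃ C : ℝ, 0 ≤ C ∧ ∀ n : ℕ, 0 < n →
    Ex (fun f : Fin n → Fin n => ∑ γ ∈ cyc f, Real.log γ.card - Real.log (T f))
      ≤ C * (1 + Real.log n) ^ ((5 : ℝ) / 4) := by
  have hsum : Summable (fun q : ℕ => (q : ℝ) ^ (-(9 : ℝ) / 8)) :=
    Real.summable_nat_rpow.2 (by norm_num)
  refine ⟨8 * Real.exp 1 * ∑' q : ℕ, (q : ℝ) ^ (-(9 : ℝ) / 8), ?_, ?_⟩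
  · have : 0 ≤ ∑' q : ℕ, (q : ℝ) ^ (-(9 : ℝ) / 8) := tsum_nonneg fun q => by positivity
    positivity
  intro n hn
  have hL : 0 ≤ Real.log n := Real.log_natCast_nonneg n
  calc Ex (fun f : Fin n → Fin n => ∑ γ ∈ cyc f, Real.log γ.card - Real.log (T f))
      ≤ Ex (fun f : Fin n → Fin n => ∑ q ∈ Finset.Icc 1 n,
          ArithmeticFunction.vonMangoldt q * ((Dq q f - 1 : ℕ) : ℝ)) := Ex_mono fun f => le_logT f
    _ = ∑ q ∈ Finset.Icc 1 n, ArithmeticFunction.vonMangoldt q *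
          Ex (fun f : Fin n → Fin n => ((Dq q f - 1 : ℕ) : ℝ)) := by
        rw [Ex_sum]
        refine Finset.sum_congr rfl fun q _ => Ex_const_mul _ _
    _ ≤ ∑ q ∈ Finset.Icc 1 n, 8 * Real.exp 1 * (1 + Real.log n) ^ ((5 : ℝ) / 4)
          * (q : ℝ) ^ (-(9 : ℝ) / 8) := by
        refine Finset.sum_le_sum fun q hq => ?_
        rw [Finset.mem_Icc] at hq
        have hq' : (0 : ℝ) < q := by exact_mod_cast hq.1
        have h1 : ArithmeticFunction.vonMangoldt q ≤ (q : ℝ) ^ ((1 : ℝ) / 8) / (1 / 8) :=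
          ArithmeticFunction.vonMangoldt_le_log.trans (Real.log_le_rpow_div hq'.le (by norm_num))
        calc _ ≤ (q : ℝ) ^ ((1 : ℝ) / 8) / (1 / 8)
              * (((1 + Real.log n) / q) ^ ((5 : ℝ) / 4) * Real.exp 1) := by
              refine mul_le_mul h1 (Ex_Dq_le hn q hq.1) ?_ (by positivity)
              unfold Ex
              positivity
          _ = _ := by
              rw [Real.div_rpow (by positivity) hq'.le,
                show (-(9 : ℝ) / 8) = (1 : ℝ) / 8 - (5 : ℝ) / 4 by norm_num, Real.rpow_sub hq']
              field_simp
              try ring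
    _ = 8 * Real.exp 1 * (1 + Real.log n) ^ ((5 : ℝ) / 4)
          * ∑ q ∈ Finset.Icc 1 n, (q : ℝ) ^ (-(9 : ℝ) / 8) := (Finset.mul_sum _ _ _).symm
    _ ≤ 8 * Real.exp 1 * (1 + Real.log n) ^ ((5 : ℝ) / 4)
          * ∑' q : ℕ, (q : ℝ) ^ (-(9 : ℝ) / 8) := by
        gcongr
        exact hsum.sum_le_tsum _ fun q _ => by positivity
    _ = _ := by ring

lemma av_decay {n : ℕ} (hn : 0 < n) (s : ℕ) (hs : s ≤ n) :
    av n (s + 1) * (1 + s * (s + 1) / (2 * n)) ≤ 1 := by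
  have hn' : (0 : ℝ) < n := by exact_mod_cast hn
  induction s with
  | zero => simpa using av_le_one (n := n) 1
  | succ s ih =>
    have ih := ih (by omega)
    rw [av_succ hn _ hs]
    push_cast
    set x : ℝ := ((s : ℝ) + 1) / n with hx
    set A : ℝ := s * (s + 1) / (2 * n) with hA
    have hx0 : 0 ≤ x := by positivity
    have hA0 : 0 ≤ A := by positivity
    have hx1 : x ≤ 1 := by
      rw [hx, div_le_one hn']; exact_mod_cast hs
    have e : ((s : ℝ) + 1) * ((s : ℝ) + 1 + 1) / (2 * n) = A + x := by
      rw [hA, hx]; field_simp; ring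
    rw [e]
    have ha := av_nonneg n (s + 1)
    have : (1 - x) * (1 + (A + x)) ≤ 1 + A := by nlinarith
    calc av n (s + 1) * (1 - x) * (1 + (A + x)) = av n (s + 1) * ((1 - x) * (1 + (A + x))) := by ring
      _ ≤ av n (s + 1) * (1 + A) := by gcongr
      _ ≤ 1 := ih

lemma sum_large_le {n : ℕ} (hn : 0 < n) (K m : ℕ) (hK : 0 < K) (hKm : K ≤ m) (hm : n ≤ m ^ 2) :
    ∑ k ∈ Finset.range n, (if K < k + 1 then av n (k + 1) / ((k : ℝ) + 1) else 0)
      ≤ Real.log m - Real.log K + 1 := by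
  have hn' : (0 : ℝ) < n := by exact_mod_cast hn
  have hm0 : 0 < m := by omega
  have hm' : (0 : ℝ) < m := by exact_mod_cast hm0
  have hK' : (0 : ℝ) < K := by exact_mod_cast hK
  set Φ : ℕ → ℝ := fun k => Real.log (min k m : ℕ) - n / ((max k m : ℕ) : ℝ) ^ 2 with hΦ
  have hstep : ∀ k, K ≤ k → k < n → av n (k + 1) / ((k : ℝ) + 1) ≤ Φ (k + 1) - Φ k := by
    intro k hKk hkn
    have hk0 : (0 : ℝ) < k := by exact_mod_cast (by omega : 0 < k)
    rcases lt_or_ge k m with h | h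
    · simp only [hΦ]
      rw [min_eq_left (by omega : k + 1 ≤ m), min_eq_left h.le, max_eq_right (by omega : k + 1 ≤ m),
        max_eq_right h.le]
      have h1 : Real.log k - Real.log (k + 1) ≤ k / (k + 1) - 1 := by
        rw [← Real.log_div (by positivity) (by positivity)]
        exact Real.log_le_sub_one_of_pos (by positivity)
      have h2 : (k : ℝ) / (k + 1) - 1 = - (1 / ((k : ℝ) + 1)) := by field_simp; ring
      have h3 : av n (k + 1) / ((k : ℝ) + 1) ≤ 1 / ((k : ℝ) + 1) := by
        gcongr; exact av_le_one _
      push_cast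
      linarith
    · simp only [hΦ]
      rw [min_eq_right (by omega : m ≤ k + 1), min_eq_right h, max_eq_left (by omega : m ≤ k + 1),
        max_eq_left h]
      have h1 := av_decay hn k hkn.le
      have h2 : av n (k + 1) ≤ 2 * n / (k * (k + 1)) := by
        rw [le_div_iff₀ (by positivity)]
        have ha := av_nonneg n (k + 1)
        have h3 : av n (k + 1) * (k * (k + 1) / (2 * n)) ≤ 1 := by nlinarith
        calc av n (k + 1) * (k * (k + 1)) = av n (k + 1) * (k * (k + 1) / (2 * n)) * (2 * n) := by
              field_simp
          _ ≤ 1 * (2 * n) := by gcongr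
          _ = _ := one_mul _
      calc av n (k + 1) / ((k : ℝ) + 1) ≤ 2 * n / (k * (k + 1)) / ((k : ℝ) + 1) := by gcongr
        _ ≤ n * (2 * k + 1) / (k ^ 2 * (k + 1) ^ 2) := by
            rw [div_div, div_le_div_iff₀ (by positivity) (by positivity)]
            have : 0 ≤ (n : ℝ) * (k * (k + 1) ^ 2) := by positivity
            nlinarith
        _ = _ := by push_cast; field_simp; ring
  have hmono : ∀ N, N ≤ n → ∑ k ∈ Finset.range N, (if K < k + 1 then av n (k + 1) / ((k : ℝ) + 1) else 0)
      ≤ Φ (max K N) - Φ K := by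
    intro N hN
    induction N with
    | zero => simp
    | succ N ih =>
      rw [Finset.sum_range_succ]
      have ih := ih (by omega)
      split_ifs with h
      · rw [max_eq_right (by omega : K ≤ N)] at ih
        rw [max_eq_right (by omega : K ≤ N + 1)]
        linarith [hstep N (by omega) (by omega)]
      · rw [max_eq_left (by omega : N ≤ K)] at ih
        rw [max_eq_left (by omega : N + 1 ≤ K)]
        linarith
  refine (hmono n le_rfl).trans ?_
  have h1 : Φ (max K n) ≤ Real.log m := by
    simp only [hΦ]
    have : Real.log ((min (max K n) m : ℕ) : ℝ) ≤ Real.log m := by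
      apply Real.log_le_log
      · exact_mod_cast (by omega : 0 < min (max K n) m)
      · exact_mod_cast min_le_right _ _
    have h2 : 0 ≤ (n : ℝ) / ((max (max K n) m : ℕ) : ℝ) ^ 2 := by positivity
    linarith
  have h2 : Real.log K - 1 ≤ Φ K := by
    simp only [hΦ]
    rw [min_eq_left hKm, max_eq_right hKm]
    have : (n : ℝ) / (m : ℝ) ^ 2 ≤ 1 := by
      rw [div_le_one (by positivity)]; exact_mod_cast hm
    linarith
  linarith

lemma Ex_large_le {n : ℕ} (hn : 0 < n) (K m : ℕ) (hK : 0 < K) (hKm : K ≤ m) (hm : n ≤ m ^ 2) :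
    Ex (fun f : Fin n → Fin n => ∑ γ ∈ (cyc f).filter (fun γ => K < γ.card), Real.log γ.card)
      ≤ Real.log n * ((Real.log m - Real.log K + 1) * Real.exp 1) := by
  have hK' : (0 : ℝ) < K := by exact_mod_cast hK
  have h0 : Real.log K ≤ Real.log m := Real.log_le_log hK' (by exact_mod_cast hKm)
  refine le_trans ?_ (mul_le_mul_of_nonneg_left
    (Ex_count_le hn (fun k => K < k) (Real.log m - Real.log K + 1) (by linarith)
      (sum_large_le hn K m hK hKm hm)) (Real.log_natCast_nonneg n))
  rw [← Ex_const_mul]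
  refine Ex_mono fun f => ?_
  unfold Dp
  rw [mul_comm, ← nsmul_eq_mul]
  refine Finset.sum_le_card_nsmul _ _ _ fun γ hγ => ?_
  rw [Finset.mem_filter] at hγ
  apply Real.log_le_log
  · exact_mod_cast (by omega : 0 < γ.card)
  · exact_mod_cast card_le_of_cyc γ

lemma log_step (k : ℕ) (hk : 1 ≤ k) :
    1 / ((k : ℝ) + 1) ≤ Real.log ((k : ℝ) + 1) - Real.log k ∧
      Real.log ((k : ℝ) + 1) - Real.log k ≤ 1 / (k : ℝ) := by
  have hk0 : (0 : ℝ) < k := by exact_mod_cast (by omega : 0 < k)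
  constructor
  · have h1 : Real.log k - Real.log (k + 1) ≤ k / (k + 1) - 1 := by
      rw [← Real.log_div (by positivity) (by positivity)]
      exact Real.log_le_sub_one_of_pos (by positivity)
    have h2 : (k : ℝ) / (k + 1) - 1 = - (1 / ((k : ℝ) + 1)) := by field_simp; ring
    linarith
  · have h1 : Real.log (k + 1) - Real.log k ≤ (k + 1) / k - 1 := by
      rw [← Real.log_div (by positivity) (by positivity)]
      exact Real.log_le_sub_one_of_pos (by positivity)
    have h2 : ((k : ℝ) + 1) / k - 1 = 1 / (k : ℝ) := by field_simp; ring
    linarith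

lemma step_facts (k K : ℕ) (hk : 1 ≤ k) (hK : k + 1 ≤ K) :
    0 ≤ Real.log k ∧ Real.log k ≤ Real.log ((k : ℝ) + 1) ∧ Real.log ((k : ℝ) + 1) ≤ Real.log K ∧
    (Real.log ((k : ℝ) + 1) - Real.log k) ^ 2 ≤ 2 * (1 / (k : ℝ) - 1 / ((k : ℝ) + 1)) := by
  have hk1 : (1 : ℝ) ≤ k := by exact_mod_cast hk
  have h := log_step k hk
  have hp : 0 < 1 / ((k : ℝ) + 1) := by positivity
  refine ⟨Real.log_natCast_nonneg k, by linarith, ?_, ?_⟩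
  · apply Real.log_le_log (by positivity); exact_mod_cast hK
  · calc (Real.log ((k : ℝ) + 1) - Real.log k) ^ 2 ≤ (1 / (k : ℝ)) ^ 2 :=
        pow_le_pow_left₀ (by linarith) h.2 2
      _ ≤ _ := by
        rw [div_sub_div _ _ (by positivity) (by positivity), div_pow, ← mul_div_assoc,
          div_le_div_iff₀ (by positivity) (by positivity)]
        nlinarith

lemma sum_log1 (K : ℕ) (hK : 1 ≤ K) :
    |∑ k ∈ Finset.range K, Real.log ((k : ℝ) + 1) / ((k : ℝ) + 1) - Real.log K ^ 2 / 2|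
      ≤ Real.log K + 1 := by
  have hl : 0 ≤ Real.log K := Real.log_natCast_nonneg K
  have key : ∀ N : ℕ, N + 1 ≤ K →
      |∑ k ∈ Finset.range (N + 1), Real.log ((k : ℝ) + 1) / ((k : ℝ) + 1)
        - Real.log ((N : ℝ) + 1) ^ 2 / 2| ≤ (Real.log K + 1) * (1 - 1 / ((N : ℝ) + 1)) := by
    intro N
    induction N with
    | zero => intro _; simp
    | succ N ih =>
      intro hN
      have ih := ih (by omega)
      have h1 := log_step (N + 1) (by omega)
      obtain ⟨h2, h3, h4, h5⟩ := step_facts (N + 1) K (by omega) hN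
      push_cast at h1 h2 h3 h4 h5 ⊢
      rw [Finset.sum_range_succ]
      push_cast
      rw [div_eq_mul_one_div (Real.log ((N : ℝ) + 1 + 1)) ((N : ℝ) + 1 + 1)]
      generalize Real.log ((N : ℝ) + 1 + 1) = x at *
      generalize Real.log ((N : ℝ) + 1) = y at *
      generalize 1 / ((N : ℝ) + 1 + 1) = h at *
      generalize 1 / ((N : ℝ) + 1) = g at *
      generalize ∑ k ∈ Finset.range (N + 1), Real.log ((k : ℝ) + 1) / ((k : ℝ) + 1) = S at *
      generalize Real.log (K : ℝ) = l at *
      rw [abs_le] at ih ⊢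
      have a1 : x * h ≤ x * (x - y) := mul_le_mul_of_nonneg_left h1.1 (by linarith)
      have a2 : x * (x - y - h) ≤ l * (g - h) :=
        mul_le_mul h4 (by linarith) (by linarith) (by linarith)
      constructor <;> nlinarith [sq_nonneg (x - y)]
  have := key (K - 1) (by omega)
  rw [Nat.sub_add_cancel hK, Nat.cast_sub hK] at this
  simp only [Nat.cast_one, sub_add_cancel] at this
  refine this.trans ?_
  have hp : 0 ≤ 1 / (K : ℝ) := by positivity
  nlinarith

lemma sum_log2 (K : ℕ) (hK : 1 ≤ K) :
    |∑ k ∈ Finset.range K, Real.log ((k : ℝ) + 1) ^ 2 / ((k : ℝ) + 1) - Real.log K ^ 3 / 3|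
      ≤ Real.log K ^ 2 + 4 * Real.log K := by
  have hl : 0 ≤ Real.log K := Real.log_natCast_nonneg K
  have key : ∀ N : ℕ, N + 1 ≤ K →
      |∑ k ∈ Finset.range (N + 1), Real.log ((k : ℝ) + 1) ^ 2 / ((k : ℝ) + 1)
        - Real.log ((N : ℝ) + 1) ^ 3 / 3|
          ≤ (Real.log K ^ 2 + 4 * Real.log K) * (1 - 1 / ((N : ℝ) + 1)) := by
    intro N
    induction N with
    | zero => intro _; simp
    | succ N ih =>
      intro hN
      have ih := ih (by omega)
      have h1 := log_step (N + 1) (by omega)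
      obtain ⟨h2, h3, h4, h5⟩ := step_facts (N + 1) K (by omega) hN
      push_cast at h1 h2 h3 h4 h5 ⊢
      rw [Finset.sum_range_succ]
      push_cast
      rw [div_eq_mul_one_div (Real.log ((N : ℝ) + 1 + 1) ^ 2) ((N : ℝ) + 1 + 1)]
      generalize Real.log ((N : ℝ) + 1 + 1) = x at *
      generalize Real.log ((N : ℝ) + 1) = y at *
      generalize 1 / ((N : ℝ) + 1 + 1) = h at *
      generalize 1 / ((N : ℝ) + 1) = g at *
      generalize ∑ k ∈ Finset.range (N + 1), Real.log ((k : ℝ) + 1) ^ 2 / ((k : ℝ) + 1) = S at *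
      generalize Real.log (K : ℝ) = l at *
      rw [abs_le] at ih ⊢
      have x0 : 0 ≤ x := by linarith
      have hgh : 0 ≤ g - h := by linarith
      have a1 : x ^ 2 * h ≤ x ^ 2 * (x - y) := mul_le_mul_of_nonneg_left h1.1 (sq_nonneg x)
      have a2 : x ^ 2 * (x - y - h) ≤ l ^ 2 * (g - h) :=
        mul_le_mul (pow_le_pow_left₀ x0 h4 2) (by linarith) (by linarith) (sq_nonneg l)
      have a3 : x * (x - y) ^ 2 ≤ l * (2 * (g - h)) :=
        mul_le_mul h4 h5 (sq_nonneg _) hl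
      have e1 : x ^ 3 - y ^ 3 = 3 * x ^ 2 * (x - y) - 3 * x * (x - y) ^ 2 + (x - y) ^ 3 := by ring
      have a4 : 0 ≤ (x - y) ^ 3 := pow_nonneg (by linarith) 3
      have a5 : (x - y) ^ 3 ≤ x * (x - y) ^ 2 := by
        have : (x - y) ^ 3 = (x - y) * (x - y) ^ 2 := by ring
        rw [this]; exact mul_le_mul_of_nonneg_right (by linarith) (sq_nonneg _)
      have a6 : 0 ≤ l * (g - h) := mul_nonneg hl hgh
      have a7 : 0 ≤ l ^ 2 * (g - h) := mul_nonneg (sq_nonneg l) hgh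
      constructor
      · linarith
      · linarith
  have := key (K - 1) (by omega)
  rw [Nat.sub_add_cancel hK, Nat.cast_sub hK] at this
  simp only [Nat.cast_one, sub_add_cancel] at this
  refine this.trans ?_
  have hp : 0 ≤ 1 / (K : ℝ) := by positivity
  nlinarith [mul_nonneg hp hl, mul_nonneg hp (sq_nonneg (Real.log K))]

lemma harm_le (K : ℕ) : ∑ j ∈ Finset.range K, 1 / ((j : ℝ) + 1) ≤ 1 + Real.log K := by
  have := harmonic_le_one_add_log K
  simpa [harmonic] using this

lemma sum_log3 (K : ℕ) :
    ∑ k ∈ Finset.range K, Real.log ((k : ℝ) + 1) ^ 3 / ((k : ℝ) + 1)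
      ≤ Real.log K ^ 3 * (1 + Real.log K) := by
  calc _ ≤ ∑ k ∈ Finset.range K, Real.log K ^ 3 * (1 / ((k : ℝ) + 1)) := by
        refine Finset.sum_le_sum fun k hk => ?_
        rw [Finset.mem_range] at hk
        rw [div_eq_mul_one_div]
        gcongr
        · have : (0 : ℝ) ≤ k := by positivity
          exact Real.log_nonneg (by linarith)
        · exact_mod_cast hk
    _ = Real.log K ^ 3 * ∑ k ∈ Finset.range K, (1 / ((k : ℝ) + 1)) := (Finset.mul_sum _ _ _).symm
    _ ≤ _ := mul_le_mul_of_nonneg_left (harm_le K) (pow_nonneg (Real.log_natCast_nonneg K) 3)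

/-- the exponent -/
lemma exponent_approx (K : ℕ) (hK : 1 ≤ K) (t : ℝ) (ht : |t| * Real.log K ≤ 1) :
    ‖(∑ k ∈ Finset.range K, (Complex.exp (((t * Real.log ((k : ℝ) + 1) : ℝ) : ℂ) * Complex.I) - 1)
        / ((k : ℂ) + 1))
      - (((t * (Real.log K ^ 2 / 2) : ℝ) : ℂ) * Complex.I
        - ((t ^ 2 / 2 * (Real.log K ^ 3 / 3) : ℝ) : ℂ))‖
      ≤ |t| * (Real.log K + 1) + t ^ 2 / 2 * (Real.log K ^ 2 + 4 * Real.log K)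
        + |t| ^ 3 * (Real.log K ^ 3 * (1 + Real.log K)) := by
  set y : ℕ → ℝ := fun k => t * Real.log ((k : ℝ) + 1) with hy
  set S1 := ∑ k ∈ Finset.range K, Real.log ((k : ℝ) + 1) / ((k : ℝ) + 1) with hS1
  set S2 := ∑ k ∈ Finset.range K, Real.log ((k : ℝ) + 1) ^ 2 / ((k : ℝ) + 1) with hS2
  have e1 : (∑ k ∈ Finset.range K, (((y k : ℝ) : ℂ) * Complex.I + (((y k : ℝ) : ℂ) * Complex.I) ^ 2 / 2)
        / ((k : ℂ) + 1)) = ((t * S1 : ℝ) : ℂ) * Complex.I - ((t ^ 2 / 2 * S2 : ℝ) : ℂ) := by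
    rw [hS1, hS2]
    push_cast
    rw [Finset.mul_sum, Finset.mul_sum, Finset.sum_mul, ← Finset.sum_sub_distrib]
    refine Finset.sum_congr rfl fun k _ => ?_
    rw [mul_pow, Complex.I_sq]
    simp only [hy]
    push_cast
    ring
  have b1 : ‖(∑ k ∈ Finset.range K, (Complex.exp (((y k : ℝ) : ℂ) * Complex.I) - 1) / ((k : ℂ) + 1))
      - ∑ k ∈ Finset.range K, (((y k : ℝ) : ℂ) * Complex.I + (((y k : ℝ) : ℂ) * Complex.I) ^ 2 / 2)
        / ((k : ℂ) + 1)‖ ≤ |t| ^ 3 * (Real.log K ^ 3 * (1 + Real.log K)) := by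
    rw [← Finset.sum_sub_distrib]
    refine (norm_sum_le _ _).trans ?_
    refine le_trans ?_ (mul_le_mul_of_nonneg_left (sum_log3 K) (by positivity))
    rw [Finset.mul_sum]
    refine Finset.sum_le_sum fun k hk => ?_
    rw [Finset.mem_range] at hk
    have hk0 : (0 : ℝ) ≤ k := by positivity
    have hlk : 0 ≤ Real.log ((k : ℝ) + 1) := Real.log_nonneg (by linarith)
    have hlK : Real.log ((k : ℝ) + 1) ≤ Real.log K :=
      Real.log_le_log (by positivity) (by exact_mod_cast hk)
    have hyk : |y k| = |t| * Real.log ((k : ℝ) + 1) := by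
      simp only [hy]; rw [abs_mul, abs_of_nonneg hlk]
    have hyn : ‖((y k : ℝ) : ℂ) * Complex.I‖ = |y k| := by simp
    have hy1 : ‖((y k : ℝ) : ℂ) * Complex.I‖ ≤ 1 := by
      rw [hyn, hyk]
      exact (mul_le_mul_of_nonneg_left hlK (abs_nonneg t)).trans ht
    have hb := Complex.exp_bound hy1 (n := 3) (by norm_num)
    rw [hyn] at hb
    have hnum : ‖Complex.exp (((y k : ℝ) : ℂ) * Complex.I) - 1
        - (((y k : ℝ) : ℂ) * Complex.I + (((y k : ℝ) : ℂ) * Complex.I) ^ 2 / 2)‖ ≤ |y k| ^ 3 := by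
      have e : ∑ m ∈ Finset.range 3, (((y k : ℝ) : ℂ) * Complex.I) ^ m / (m.factorial : ℂ)
          = 1 + (((y k : ℝ) : ℂ) * Complex.I + (((y k : ℝ) : ℂ) * Complex.I) ^ 2 / 2) := by
        simp [Finset.sum_range_succ, Nat.factorial]; ring
      rw [e] at hb
      rw [sub_sub]
      refine hb.trans ?_
      apply mul_le_of_le_one_right (by positivity)
      norm_num [Nat.factorial]
    have hd : ‖(k : ℂ) + 1‖ = (k : ℝ) + 1 := by
      have : ((k : ℂ) + 1) = (((k : ℝ) + 1 : ℝ) : ℂ) := by push_cast; rfl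
      rw [this, Complex.norm_real, Real.norm_of_nonneg (by positivity)]
    rw [← sub_div, norm_div, hd, ← mul_div_assoc]
    rw [hyk, mul_pow |t|] at hnum
    gcongr
  have b2 : ‖(((t * S1 : ℝ) : ℂ) * Complex.I - ((t ^ 2 / 2 * S2 : ℝ) : ℂ))
      - (((t * (Real.log K ^ 2 / 2) : ℝ) : ℂ) * Complex.I
        - ((t ^ 2 / 2 * (Real.log K ^ 3 / 3) : ℝ) : ℂ))‖
      ≤ |t| * (Real.log K + 1) + t ^ 2 / 2 * (Real.log K ^ 2 + 4 * Real.log K) := by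
    have e : (((t * S1 : ℝ) : ℂ) * Complex.I - ((t ^ 2 / 2 * S2 : ℝ) : ℂ))
      - (((t * (Real.log K ^ 2 / 2) : ℝ) : ℂ) * Complex.I
        - ((t ^ 2 / 2 * (Real.log K ^ 3 / 3) : ℝ) : ℂ))
      = ((t * (S1 - Real.log K ^ 2 / 2) : ℝ) : ℂ) * Complex.I
        - ((t ^ 2 / 2 * (S2 - Real.log K ^ 3 / 3) : ℝ) : ℂ) := by
      push_cast; ring
    rw [e]
    refine (norm_sub_le _ _).trans (add_le_add ?_ ?_)
    · rw [norm_mul, Complex.norm_I, mul_one, Complex.norm_real, Real.norm_eq_abs, abs_mul]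
      exact mul_le_mul_of_nonneg_left (sum_log1 K hK) (abs_nonneg t)
    · rw [Complex.norm_real, Real.norm_eq_abs, abs_mul, abs_of_nonneg (by positivity)]
      exact mul_le_mul_of_nonneg_left (sum_log2 K hK) (by positivity)
  rw [e1] at b1
  have := norm_add_le_of_le b1 b2
  rw [sub_add_sub_cancel] at this
  linarith

/-- truncation point -/
noncomputable def KK (n : ℕ) : ℕ := ⌊Real.exp (Real.log n / 2) / Real.log n ^ 3⌋₊
/-- tail point -/
noncomputable def SS (n : ℕ) : ℕ := ⌊Real.exp (Real.log n / 2) / Real.log n⌋₊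
/-- square root of the logarithm -/
noncomputable def sL (n : ℕ) : ℝ := Real.sqrt (Real.log n)
/-- the scale -/
noncomputable def bb (n : ℕ) : ℝ := (1 / Real.sqrt 24) * (Real.log n) ^ ((3 : ℝ) / 2)

lemma tendsto_logn : Filter.Tendsto (fun n : ℕ => Real.log n) Filter.atTop Filter.atTop :=
  Real.tendsto_log_atTop.comp tendsto_natCast_atTop_atTop

lemma tendsto_sL : Filter.Tendsto sL Filter.atTop Filter.atTop :=
  Real.tendsto_sqrt_atTop.comp tendsto_logn

lemma sL_sq (n : ℕ) : sL n ^ 2 = Real.log n := Real.sq_sqrt (Real.log_natCast_nonneg n)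

lemma bb_eq (n : ℕ) : bb n = sL n ^ 3 / Real.sqrt 24 := by
  unfold bb sL
  have h := Real.log_natCast_nonneg n
  rw [Real.sqrt_eq_rpow (Real.log n), ← Real.rpow_natCast, ← Real.rpow_mul h]
  norm_num
  ring

lemma KK_spec : ∀ᶠ n : ℕ in Filter.atTop, 0 < n ∧ 1 ≤ Real.log n ∧ 1 ≤ KK n ∧
    Real.log (KK n) ≤ Real.log n / 2 ∧
    Real.log n / 2 - 3 * Real.log (Real.log n) - Real.log 2 ≤ Real.log (KK n) ∧
    Real.log n ^ 2 / 4 * (KK n + 1) ≤ SS n ∧ SS n ≤ n ∧ (SS n : ℝ) ^ 2 / n ≤ 1 / Real.log n ^ 2 ∧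
    (KK n : ℝ) ≤ Real.exp (Real.log n / 2) := by
  have h1 : ∀ᶠ n : ℕ in Filter.atTop, (16 : ℝ) ≤ Real.exp (Real.log n / 2) / (Real.log n / 2) ^ 3 := by
    have := (Real.tendsto_exp_div_pow_atTop 3).comp
      (tendsto_logn.atTop_div_const (show (0 : ℝ) < 2 by norm_num))
    exact this.eventually_ge_atTop 16
  filter_upwards [h1, tendsto_logn.eventually_ge_atTop 1, Filter.eventually_gt_atTop 0] with n h1 hL hn
  have hn' : (0 : ℝ) < n := by exact_mod_cast hn
  have hR2 : Real.exp (Real.log n / 2) ^ 2 = n := by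
    rw [← Real.exp_nat_mul]
    push_cast
    rw [mul_div_cancel₀ _ (by norm_num), Real.exp_log hn']
  unfold KK SS
  set L := Real.log n with hLd
  set R := Real.exp (L / 2) with hR
  have hR0 : 0 < R := Real.exp_pos _
  have hL0 : 0 < L := by linarith
  have hlogR : Real.log R = L / 2 := Real.log_exp _
  set X := R / L ^ 3 with hX
  have hX0 : 0 < X := by positivity
  have hX2 : 2 ≤ X := by
    have : R / (L / 2) ^ 3 = 8 * X := by rw [hX]; field_simp; norm_num
    rw [this] at h1; linarith
  have hRL : R / L = X * L ^ 2 := by rw [hX]; field_simp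
  have hk1 : (⌊X⌋₊ : ℝ) ≤ X := Nat.floor_le hX0.le
  have hk2 : X < ⌊X⌋₊ + 1 := Nat.lt_floor_add_one X
  have hs1 : (⌊R / L⌋₊ : ℝ) ≤ R / L := Nat.floor_le (by positivity)
  have hs2 : R / L < ⌊R / L⌋₊ + 1 := Nat.lt_floor_add_one _
  have hL2 : 1 ≤ L ^ 2 := one_le_pow₀ hL
  have hXR : X ≤ R := div_le_self hR0.le (one_le_pow₀ hL)
  have hkpos : (0 : ℝ) < ⌊X⌋₊ := by linarith
  have hR1 : 1 ≤ R := by linarith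
  refine ⟨hn, hL, ?_, ?_, ?_, ?_, ?_, ?_, ?_⟩
  · exact_mod_cast hkpos
  · rw [← hlogR]; exact Real.log_le_log hkpos (by linarith)
  · have : Real.log (X / 2) ≤ Real.log ⌊X⌋₊ := Real.log_le_log (by positivity) (by linarith)
    rw [Real.log_div hX0.ne' (by norm_num), hX, Real.log_div hR0.ne' (by positivity), Real.log_pow,
      hlogR] at this
    push_cast at this
    exact this
  · have : L ^ 2 / 4 * (⌊X⌋₊ + 1) ≤ L ^ 2 / 4 * (2 * X) := by gcongr; linarith
    nlinarith
  · have : (⌊R / L⌋₊ : ℝ) ≤ n := by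
      have h3 : R / L ≤ R := div_le_self hR0.le hL
      nlinarith
    exact_mod_cast this
  · calc (⌊R / L⌋₊ : ℝ) ^ 2 / n ≤ (R / L) ^ 2 / n := by gcongr
      _ = 1 / L ^ 2 := by rw [div_pow, hR2]; field_simp
  · linarith

/-- truncated characteristic weights -/
noncomputable def uu (K : ℕ) (t : ℝ) (k : ℕ) : ℂ :=
  if k ≤ K then Complex.exp (((t * Real.log k : ℝ) : ℂ) * Complex.I) else 1

lemma charY_err : ∀ᶠ n : ℕ in Filter.atTop, ∀ t : ℝ,
    ‖(∑ f : Fin n → Fin n, ∏ γ ∈ cyc f, uu (KK n) t γ.card) / (n : ℂ) ^ n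
      - Complex.exp (∑ k ∈ Finset.range (KK n),
        (Complex.exp (((t * Real.log ((k : ℝ) + 1) : ℝ) : ℂ) * Complex.I) - 1) / ((k : ℂ) + 1))‖
      ≤ 2 * (1 / Real.log n ^ 2)
        + Real.exp (2 * Real.exp 1 * (1 + Real.log n) - Real.log n ^ 2 / 4) := by
  filter_upwards [KK_spec] with n ⟨hn, hL, hK1, hKu, hKl, hSK, hSn, hS2, _⟩ t
  set K := KK n with hK
  have hK0 : (0 : ℝ) < K := by exact_mod_cast hK1
  have hz : (1 : ℝ) ≤ 1 + 1 / K := by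
    have : 0 < 1 / (K : ℝ) := by positivity
    linarith
  have hzK : ∀ k, k ≤ K → (1 + 1 / (K : ℝ)) ^ k ≤ Real.exp 1 := by
    intro k hk
    calc (1 + 1 / (K : ℝ)) ^ k ≤ (1 + 1 / (K : ℝ)) ^ K := pow_le_pow_right₀ hz hk
      _ ≤ (Real.exp (1 / K)) ^ K := by
          gcongr
          linarith [Real.add_one_le_exp (1 / (K : ℝ))]
      _ = Real.exp 1 := by rw [← Real.exp_nat_mul]; field_simp
  have hzS : Real.exp (Real.log n ^ 2 / 4) ≤ (1 + 1 / (K : ℝ)) ^ (SS n) := by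
    have h1 : Real.exp (1 / ((K : ℝ) + 1)) ≤ 1 + 1 / (K : ℝ) := by
      rw [← Real.le_log_iff_exp_le (by positivity)]
      have := (log_step K hK1).1
      rw [← Real.log_div (by positivity) (by positivity)] at this
      rwa [show 1 + 1 / (K : ℝ) = ((K : ℝ) + 1) / K by field_simp; try ring]
    calc Real.exp (Real.log n ^ 2 / 4) ≤ Real.exp ((SS n : ℝ) * (1 / ((K : ℝ) + 1))) := by
          apply Real.exp_le_exp.2
          rw [mul_one_div, le_div_iff₀ (by positivity)]
          exact hSK
      _ = (Real.exp (1 / ((K : ℝ) + 1))) ^ (SS n) := Real.exp_nat_mul _ _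
      _ ≤ _ := by gcongr
  have h := charfn_approx hn (uu K t) (by
      intro k
      unfold uu
      split_ifs
      · rw [Complex.norm_exp_ofReal_mul_I]
      · simp) K (by
      intro k hk
      unfold uu
      rw [if_neg (by omega)]) (SS n) hSn (1 + 1 / K) hz (2 * Real.exp 1 * (1 + Real.log n)) (by
      calc ∑ k ∈ Finset.range K, 2 * (1 + 1 / (K : ℝ)) ^ (k + 1) / ((k : ℝ) + 1)
          ≤ ∑ k ∈ Finset.range K, 2 * Real.exp 1 * (1 / ((k : ℝ) + 1)) := by
            refine Finset.sum_le_sum fun k hk => ?_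
            rw [Finset.mem_range] at hk
            rw [div_eq_mul_one_div]
            gcongr
            exact hzK (k + 1) hk
        _ = 2 * Real.exp 1 * ∑ k ∈ Finset.range K, (1 / ((k : ℝ) + 1)) := (Finset.mul_sum _ _ _).symm
        _ ≤ 2 * Real.exp 1 * (1 + Real.log n) := by
            gcongr
            linarith [harm_le K])
  have e : ∑ k ∈ Finset.range K, (uu K t (k + 1) - 1) / ((k : ℂ) + 1)
      = ∑ k ∈ Finset.range K,
        (Complex.exp (((t * Real.log ((k : ℝ) + 1) : ℝ) : ℂ) * Complex.I) - 1) / ((k : ℂ) + 1) := by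
    refine Finset.sum_congr rfl fun k hk => ?_
    rw [Finset.mem_range] at hk
    unfold uu
    rw [if_pos (by omega)]
    push_cast
    rfl
  rw [e] at h
  refine h.trans (add_le_add (by gcongr) ?_)
  rw [Real.exp_sub]
  gcongr

lemma tendsto_log_div : Filter.Tendsto (fun n : ℕ => Real.log (Real.log n) / sL n)
    Filter.atTop (nhds 0) := by
  have h1 : Filter.Tendsto (fun x : ℝ => 2 * (Real.log x / x)) Filter.atTop (nhds 0) := by
    have h := Real.isLittleO_log_id_atTop.tendsto_div_nhds_zero
    simpa using h.const_mul 2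
  refine (h1.comp tendsto_sL).congr fun n => ?_
  have : Real.log (Real.log n) = 2 * Real.log (sL n) := by
    rw [← sL_sq, Real.log_pow]; push_cast; rfl
  simp only [Function.comp, this]
  ring

lemma tendsto_const_div_sL (c : ℝ) : Filter.Tendsto (fun n : ℕ => c / sL n)
    Filter.atTop (nhds 0) := tendsto_sL.const_div_atTop c

lemma charY_err_tendsto : Filter.Tendsto (fun n : ℕ => 2 * (1 / Real.log n ^ 2)
        + Real.exp (2 * Real.exp 1 * (1 + Real.log n) - Real.log n ^ 2 / 4))
    Filter.atTop (nhds 0) := by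
  have h1 : Filter.Tendsto (fun x : ℝ => 2 * (1 / x ^ 2)
        + Real.exp (2 * Real.exp 1 * (1 + x) - x ^ 2 / 4)) Filter.atTop (nhds 0) := by
    have a : Filter.Tendsto (fun x : ℝ => 2 * (1 / x ^ 2)) Filter.atTop (nhds 0) := by
      have := (Filter.tendsto_pow_atTop (α := ℝ) (n := 2) (by norm_num)).const_div_atTop 1
      simpa using this.const_mul 2
    have b : Filter.Tendsto (fun x : ℝ => Real.exp (2 * Real.exp 1 * (1 + x) - x ^ 2 / 4))
        Filter.atTop (nhds 0) := by
      apply Real.tendsto_exp_atBot.comp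
      have hc : Filter.Tendsto (fun x : ℝ => 2 * Real.exp 1 - x) Filter.atTop Filter.atBot := by
        apply Filter.tendsto_atBot_mono' _ _ (Filter.tendsto_neg_atTop_atBot.comp
          (Filter.tendsto_atTop_add_const_right _ (-(2 * Real.exp 1)) Filter.tendsto_id))
        filter_upwards with x
        simp only [Function.comp, id]; linarith
      apply Filter.tendsto_atBot_mono' _ _ hc
      filter_upwards [Filter.eventually_ge_atTop (4 * (2 * Real.exp 1 + 1)),
        Filter.eventually_ge_atTop 0] with x hx hx0
      nlinarith
    simpa using a.add b
  exact h1.comp tendsto_logn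

lemma ratio_tendsto : Filter.Tendsto (fun n : ℕ => Real.log (KK n) / Real.log n)
    Filter.atTop (nhds (1 / 2)) := by
  have hz : Filter.Tendsto (fun n : ℕ => 1 / 2 - (3 * (Real.log (Real.log n) / sL n)
      + Real.log 2 / sL n)) Filter.atTop (nhds (1 / 2)) := by
    have := ((tendsto_log_div.const_mul 3).add
      (tendsto_const_div_sL (Real.log 2))).const_sub (1 / 2 : ℝ)
    rwa [mul_zero, add_zero, sub_zero] at this
  refine tendsto_of_tendsto_of_tendsto_of_le_of_le' hz tendsto_const_nhds ?_ ?_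
  · filter_upwards [KK_spec, tendsto_sL.eventually_ge_atTop 1] with n ⟨hn, hL, hK1, hKu, hKl, _⟩ hs
    rw [le_div_iff₀ (by linarith)]
    have h1 : 0 ≤ Real.log (Real.log n) := Real.log_nonneg hL
    have h2 : 0 ≤ Real.log 2 := Real.log_nonneg (by norm_num)
    have e : (1 / 2 - (3 * (Real.log (Real.log n) / sL n) + Real.log 2 / sL n)) * Real.log n
        = Real.log n / 2 - (3 * Real.log (Real.log n) + Real.log 2) * sL n := by
      have : sL n ≠ 0 := by linarith
      rw [← sL_sq n] at *
      field_simp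
    rw [e]
    nlinarith
  · filter_upwards [KK_spec] with n ⟨hn, hL, hK1, hKu, hKl, _⟩
    rw [div_le_iff₀ (by linarith)]; linarith

lemma exponent_tendsto (θ : ℝ) : Filter.Tendsto (fun n : ℕ =>
    (∑ k ∈ Finset.range (KK n),
        (Complex.exp (((θ / bb n * Real.log ((k : ℝ) + 1) : ℝ) : ℂ) * Complex.I) - 1) / ((k : ℂ) + 1))
      - ((θ / bb n * ((1 / 8) * Real.log n ^ 2) : ℝ) : ℂ) * Complex.I)
    Filter.atTop (nhds (-((θ : ℂ) ^ 2 / 2))) := by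
  set c : ℝ := θ * Real.sqrt 24 with hc
  have hc2 : c ^ 2 = 24 * θ ^ 2 := by
    rw [hc, mul_pow, Real.sq_sqrt (by norm_num)]; ring
  have ht : ∀ n, θ / bb n = c / sL n ^ 3 := by
    intro n
    rw [bb_eq, hc]; field_simp
  -- the three pieces
  have p1 : Filter.Tendsto (fun n : ℕ =>
    (∑ k ∈ Finset.range (KK n),
        (Complex.exp (((θ / bb n * Real.log ((k : ℝ) + 1) : ℝ) : ℂ) * Complex.I) - 1) / ((k : ℂ) + 1))
      - (((θ / bb n * (Real.log (KK n) ^ 2 / 2) : ℝ) : ℂ) * Complex.I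
        - (((θ / bb n) ^ 2 / 2 * (Real.log (KK n) ^ 3 / 3) : ℝ) : ℂ))) Filter.atTop (nhds 0) := by
    have hb : Filter.Tendsto (fun n : ℕ => (2 * |c| + 5 * c ^ 2 + 2 * |c| ^ 3) / sL n)
        Filter.atTop (nhds 0) := tendsto_const_div_sL _
    refine squeeze_zero_norm' ?_ hb
    filter_upwards [KK_spec, tendsto_sL.eventually_ge_atTop (1 + |c|)]
      with n ⟨hn, hL, hK1, hKu, hKl, _⟩ hs
    have hc0 : 0 ≤ |c| := abs_nonneg c
    have hs0 : 0 < sL n := by linarith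
    have hs1 : 1 ≤ sL n := by linarith
    have hl0 : 0 ≤ Real.log (KK n) := Real.log_natCast_nonneg _
    have hlL : Real.log (KK n) ≤ sL n ^ 2 := by rw [sL_sq]; linarith
    have hta : |θ / bb n| = |c| / sL n ^ 3 := by
      rw [ht, abs_div, abs_of_pos (by positivity : 0 < sL n ^ 3)]
    have hs2 : 1 ≤ sL n ^ 2 := one_le_pow₀ hs1
    have h := exponent_approx (KK n) hK1 (θ / bb n) (by
      rw [hta]
      calc |c| / sL n ^ 3 * Real.log (KK n) ≤ |c| / sL n ^ 3 * sL n ^ 2 := by gcongr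
        _ = |c| / sL n := by field_simp
        _ ≤ 1 := by rw [div_le_one hs0]; linarith)
    refine h.trans ?_
    rw [hta, ht, div_pow]
    generalize Real.log (KK n) = l at *
    generalize sL n = s at *
    have b1 : |c| / s ^ 3 * (l + 1) ≤ 2 * |c| / s := by
      calc |c| / s ^ 3 * (l + 1) ≤ |c| / s ^ 3 * (2 * s ^ 2) := by gcongr; linarith
        _ = 2 * |c| / s := by field_simp
    have b2 : c ^ 2 / (s ^ 3) ^ 2 / 2 * (l ^ 2 + 4 * l) ≤ 5 * c ^ 2 / s := by
      have hq : l ^ 2 + 4 * l ≤ 5 * s ^ 4 := by nlinarith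
      calc c ^ 2 / (s ^ 3) ^ 2 / 2 * (l ^ 2 + 4 * l) ≤ c ^ 2 / (s ^ 3) ^ 2 / 2 * (5 * s ^ 4) := by
            gcongr
        _ = 5 * c ^ 2 / s * (1 / (2 * s)) := by field_simp
        _ ≤ 5 * c ^ 2 / s * 1 := by
            gcongr
            rw [div_le_one (by positivity)]; linarith
        _ = _ := mul_one _
    have b3 : (|c| / s ^ 3) ^ 3 * (l ^ 3 * (1 + l)) ≤ 2 * |c| ^ 3 / s := by
      calc (|c| / s ^ 3) ^ 3 * (l ^ 3 * (1 + l)) ≤ (|c| / s ^ 3) ^ 3 * ((s ^ 2) ^ 3 * (2 * s ^ 2)) := by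
            gcongr; linarith
        _ = 2 * |c| ^ 3 / s := by field_simp
    have e : (2 * |c| + 5 * c ^ 2 + 2 * |c| ^ 3) / s
        = 2 * |c| / s + 5 * c ^ 2 / s + 2 * |c| ^ 3 / s := by ring
    rw [e]
    linarith
  have p2 : Filter.Tendsto (fun n : ℕ =>
      ((θ / bb n * (Real.log (KK n) ^ 2 / 2 - (1 / 8) * Real.log n ^ 2) : ℝ) : ℂ) * Complex.I)
      Filter.atTop (nhds 0) := by
    have hb : Filter.Tendsto (fun n : ℕ => |c| * (3 * (Real.log (Real.log n) / sL n)
      + Real.log 2 / sL n)) Filter.atTop (nhds 0) := by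
      simpa using ((tendsto_log_div.const_mul 3).add (tendsto_const_div_sL (Real.log 2))).const_mul |c|
    refine squeeze_zero_norm' ?_ hb
    filter_upwards [KK_spec, tendsto_sL.eventually_ge_atTop 1]
      with n ⟨hn, hL, hK1, hKu, hKl, _⟩ hs
    have hs0 : 0 < sL n := by linarith
    rw [norm_mul, Complex.norm_I, mul_one, Complex.norm_real, Real.norm_eq_abs, abs_mul, ht, abs_div,
      abs_of_pos (by positivity : 0 < sL n ^ 3)]
    have hl0 : 0 ≤ Real.log (KK n) := Real.log_natCast_nonneg _
    have h1 : 0 ≤ Real.log (Real.log n) := Real.log_nonneg hL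
    have h2 : 0 ≤ Real.log 2 := Real.log_nonneg (by norm_num)
    have hb : |Real.log (KK n) ^ 2 / 2 - 1 / 8 * Real.log n ^ 2|
        ≤ (3 * Real.log (Real.log n) + Real.log 2) * sL n ^ 2 := by
      rw [sL_sq, abs_le]
      constructor <;> nlinarith
    calc |c| / sL n ^ 3 * |Real.log (KK n) ^ 2 / 2 - 1 / 8 * Real.log n ^ 2|
        ≤ |c| / sL n ^ 3 * ((3 * Real.log (Real.log n) + Real.log 2) * sL n ^ 2) := by gcongr
      _ = _ := by field_simp
  have p3 : Filter.Tendsto (fun n : ℕ =>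
      (((θ / bb n) ^ 2 / 2 * (Real.log (KK n) ^ 3 / 3) : ℝ) : ℂ))
      Filter.atTop (nhds ((θ : ℂ) ^ 2 / 2)) := by
    have hr : Filter.Tendsto (fun n : ℕ => (4 * θ ^ 2 * (Real.log (KK n) / Real.log n) ^ 3 : ℝ))
        Filter.atTop (nhds (θ ^ 2 / 2)) := by
      have := (ratio_tendsto.pow 3).const_mul (4 * θ ^ 2)
      convert this using 2
      ring
    have hr2 := (Complex.continuous_ofReal.tendsto _).comp hr
    have e : ((θ ^ 2 / 2 : ℝ) : ℂ) = (θ : ℂ) ^ 2 / 2 := by push_cast; rfl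
    rw [e] at hr2
    refine hr2.congr fun n => ?_
    simp only [Function.comp]
    congr 1
    rw [ht, div_pow c, hc2, ← sL_sq n]
    ring
  have := (p1.add p2).sub p3
  rw [add_zero, zero_sub] at this
  refine this.congr fun n => ?_
  push_cast
  ring

/-- truncated sum of logarithms -/
noncomputable def YY {n : ℕ} (K : ℕ) (f : Fin n → Fin n) : ℝ :=
  ∑ γ ∈ (cyc f).filter (fun γ => γ.card ≤ K), Real.log γ.card

lemma prod_uu {n : ℕ} (K : ℕ) (t : ℝ) (f : Fin n → Fin n) :
    ∏ γ ∈ cyc f, uu K t γ.card = Complex.exp (((t * YY K f : ℝ) : ℂ) * Complex.I) := by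
  unfold uu YY
  rw [← Finset.prod_filter, ← Complex.exp_sum]
  congr 1
  push_cast
  rw [Finset.mul_sum, Finset.sum_mul]

lemma abs_diff_le {n : ℕ} (K : ℕ) (f : Fin n → Fin n) :
    |Real.log (T f) - YY K f| ≤ (∑ γ ∈ cyc f, Real.log γ.card - Real.log (T f))
      + ∑ γ ∈ (cyc f).filter (fun γ => K < γ.card), Real.log γ.card := by
  have h1 := logT_le f
  have h2 : ∑ γ ∈ cyc f, Real.log γ.card
      = YY K f + ∑ γ ∈ (cyc f).filter (fun γ => K < γ.card), Real.log γ.card := by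
    unfold YY
    rw [← Finset.sum_filter_add_sum_filter_not (cyc f) (fun γ => γ.card ≤ K)]
    simp only [not_le]
  have h3 : 0 ≤ ∑ γ ∈ (cyc f).filter (fun γ => K < γ.card), Real.log γ.card :=
    Finset.sum_nonneg fun γ _ => Real.log_natCast_nonneg _
  rw [abs_le]
  constructor <;> linarith

lemma diff_tendsto : Filter.Tendsto
    (fun n : ℕ => Ex (fun f : Fin n → Fin n => |Real.log (T f) - YY (KK n) f|) / sL n ^ 3)
    Filter.atTop (nhds 0) := by
  obtain ⟨C, hC, hCn⟩ := Ex_logT_diff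
  have hb : Filter.Tendsto (fun n : ℕ => C * (2 : ℝ) ^ ((5 : ℝ) / 4) * (sL n) ^ (-(1 / 2) : ℝ)
      + Real.exp 1 * (3 * (Real.log (Real.log n) / sL n) + (2 * Real.log 2 + 1) / sL n))
      Filter.atTop (nhds 0) := by
    have h1 := ((tendsto_rpow_neg_atTop (show (0 : ℝ) < 1 / 2 by norm_num)).comp tendsto_sL).const_mul
      (C * (2 : ℝ) ^ ((5 : ℝ) / 4))
    have h2 := ((tendsto_log_div.const_mul 3).add
      (tendsto_const_div_sL (2 * Real.log 2 + 1))).const_mul (Real.exp 1)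
    have := h1.add h2
    simpa only [mul_zero, add_zero, Function.comp] using this
  refine squeeze_zero' (Filter.Eventually.of_forall fun n => ?_) ?_ hb
  · unfold Ex sL; positivity
  filter_upwards [KK_spec, tendsto_sL.eventually_ge_atTop 1]
      with n ⟨hn, hL, hK1, hKu, hKl, _, _, _, hKR⟩ hs
  have hs0 : 0 < sL n := by linarith
  have hn' : (0 : ℝ) < n := by exact_mod_cast hn
  set R := Real.exp (Real.log n / 2) with hR
  have hR2 : R ^ 2 = n := by
    rw [hR, ← Real.exp_nat_mul]
    push_cast
    rw [mul_div_cancel₀ _ (by norm_num), Real.exp_log hn']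
  have hR1 : 1 ≤ R := by
    rw [hR]; exact Real.one_le_exp (by linarith)
  set m := ⌊R⌋₊ + 1 with hm
  have hm1 : R < m := by rw [hm]; push_cast; exact Nat.lt_floor_add_one R
  have hm2 : (m : ℝ) ≤ 2 * R := by
    rw [hm]; push_cast; linarith [Nat.floor_le (show 0 ≤ R by linarith)]
  have hlm : Real.log m ≤ Real.log n / 2 + Real.log 2 := by
    calc Real.log m ≤ Real.log (2 * R) := Real.log_le_log (by linarith) hm2
      _ = Real.log 2 + Real.log R := Real.log_mul (by norm_num) (by positivity)
      _ = _ := by rw [hR, Real.log_exp]; ring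
  have hnm : n ≤ m ^ 2 := by
    have : (n : ℝ) ≤ (m : ℝ) ^ 2 := by rw [← hR2]; gcongr
    exact_mod_cast this
  have hKm : KK n ≤ m := by
    have : (KK n : ℝ) ≤ m := by linarith
    exact_mod_cast this
  have h1 : Ex (fun f : Fin n → Fin n => |Real.log (T f) - YY (KK n) f|)
      ≤ C * (1 + Real.log n) ^ ((5 : ℝ) / 4)
        + Real.log n * ((Real.log m - Real.log (KK n) + 1) * Real.exp 1) := by
    refine (Ex_mono (abs_diff_le (KK n))).trans ?_
    rw [Ex_add]
    exact add_le_add (hCn n hn) (Ex_large_le hn (KK n) m hK1 hKm hnm)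
  have h2 : (1 + Real.log n) ^ ((5 : ℝ) / 4) ≤ (2 : ℝ) ^ ((5 : ℝ) / 4) * sL n ^ ((5 : ℝ) / 2) := by
    calc (1 + Real.log n) ^ ((5 : ℝ) / 4) ≤ (2 * sL n ^ 2) ^ ((5 : ℝ) / 4) := by
          rw [sL_sq]; gcongr; linarith
      _ = _ := by
          rw [Real.mul_rpow (by norm_num) (by positivity), ← Real.rpow_natCast (sL n) 2,
            ← Real.rpow_mul hs0.le]
          norm_num
  have h3 : Real.log m - Real.log (KK n) + 1 ≤ 3 * Real.log (Real.log n) + (2 * Real.log 2 + 1) := by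
    linarith
  have h4 : sL n ^ ((5 : ℝ) / 2) = sL n ^ (-(1 / 2) : ℝ) * sL n ^ 3 := by
    rw [← Real.rpow_natCast (sL n) 3, ← Real.rpow_add hs0]; norm_num
  rw [div_le_iff₀ (by positivity)]
  refine h1.trans ?_
  calc _ ≤ C * ((2 : ℝ) ^ ((5 : ℝ) / 4) * sL n ^ ((5 : ℝ) / 2))
        + Real.log n * ((3 * Real.log (Real.log n) + (2 * Real.log 2 + 1)) * Real.exp 1) := by
        gcongr
    _ = _ := by
        rw [h4]
        nth_rewrite 1 [← sL_sq n]
        field_simp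

lemma norm_exp_sub_le (x y : ℝ) :
    ‖Complex.exp ((x : ℂ) * Complex.I) - Complex.exp ((y : ℂ) * Complex.I)‖ ≤ |x - y| := by
  have e : Complex.exp ((x : ℂ) * Complex.I) - Complex.exp ((y : ℂ) * Complex.I)
      = Complex.exp ((y : ℂ) * Complex.I) * (Complex.exp (Complex.I * ((x - y : ℝ) : ℂ)) - 1) := by
    rw [mul_sub, ← Complex.exp_add, mul_one]
    congr 2
    push_cast; ring
  rw [e, norm_mul, Complex.norm_exp_ofReal_mul_I, one_mul]
  exact Real.norm_exp_I_mul_ofReal_sub_one_le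

/-- normalised variable -/
noncomputable def XX {n : ℕ} (f : Fin n → Fin n) : ℝ :=
  (Real.log (T f) - (1 / 8) * (Real.log n) ^ 2) / bb n

lemma charT_tendsto (θ : ℝ) : Filter.Tendsto
    (fun n : ℕ => (∑ f : Fin n → Fin n, Complex.exp (((θ * XX f : ℝ) : ℂ) * Complex.I)) / (n : ℂ) ^ n)
    Filter.atTop (nhds (Complex.exp (-((θ : ℂ) ^ 2 / 2)))) := by
  set A : ℕ → ℂ := fun n => Complex.exp (((-(θ / bb n * ((1 / 8) * Real.log n ^ 2)) : ℝ) : ℂ) * Complex.I)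
    with hA
  set φY : ℕ → ℂ := fun n => (∑ f : Fin n → Fin n, ∏ γ ∈ cyc f, uu (KK n) (θ / bb n) γ.card) / (n : ℂ) ^ n
    with hφ
  set W : ℕ → ℂ := fun n => ∑ k ∈ Finset.range (KK n),
        (Complex.exp (((θ / bb n * Real.log ((k : ℝ) + 1) : ℝ) : ℂ) * Complex.I) - 1) / ((k : ℂ) + 1)
    with hW
  have hAn : ∀ n, ‖A n‖ = 1 := fun n => Complex.norm_exp_ofReal_mul_I _
  have l1 : Filter.Tendsto (fun n => A n * Complex.exp (W n)) Filter.atTop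
      (nhds (Complex.exp (-((θ : ℂ) ^ 2 / 2)))) := by
    have := (Complex.continuous_exp.tendsto _).comp (exponent_tendsto θ)
    refine this.congr fun n => ?_
    simp only [Function.comp, hA, hW]
    rw [← Complex.exp_add]
    congr 1
    push_cast
    ring
  have l2 : Filter.Tendsto (fun n => A n * φY n - A n * Complex.exp (W n)) Filter.atTop (nhds 0) := by
    refine squeeze_zero_norm' ?_ charY_err_tendsto
    filter_upwards [charY_err] with n hn
    rw [← mul_sub, norm_mul, hAn, one_mul]
    exact hn (θ / bb n)
  have l3 : Filter.Tendsto (fun n : ℕ =>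
      (∑ f : Fin n → Fin n, Complex.exp (((θ * XX f : ℝ) : ℂ) * Complex.I)) / (n : ℂ) ^ n
        - A n * φY n) Filter.atTop (nhds 0) := by
    have hb := diff_tendsto.const_mul (|θ| * Real.sqrt 24)
    rw [mul_zero] at hb
    refine squeeze_zero_norm' (Filter.Eventually.of_forall fun n => ?_) hb
    simp only [hφ, hA]
    rw [mul_div_assoc', ← sub_div, Finset.mul_sum, ← Finset.sum_sub_distrib, norm_div, norm_pow,
      Complex.norm_natCast]
    have hbb : |θ / bb n| = |θ| * Real.sqrt 24 / sL n ^ 3 := by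
      have : 0 ≤ sL n := Real.sqrt_nonneg _
      rw [bb_eq, abs_div, abs_of_nonneg (by positivity : 0 ≤ sL n ^ 3 / Real.sqrt 24)]
      field_simp
    have e : |θ| * Real.sqrt 24 * (Ex (fun f : Fin n → Fin n => |Real.log (T f) - YY (KK n) f|)
        / sL n ^ 3) = (∑ f : Fin n → Fin n, |θ / bb n| * |Real.log (T f) - YY (KK n) f|)
          / (n : ℝ) ^ n := by
      rw [hbb, ← Finset.mul_sum]
      unfold Ex
      ring
    rw [e]
    refine div_le_div_of_nonneg_right ?_ (by positivity)
    refine (norm_sum_le _ _).trans (Finset.sum_le_sum fun f _ => ?_)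
    rw [prod_uu, ← Complex.exp_add, ← add_mul, ← Complex.ofReal_add]
    refine (norm_exp_sub_le _ _).trans (le_of_eq ?_)
    rw [← abs_mul]
    congr 1
    unfold XX
    ring
  have := (l3.add l2).add l1
  rw [add_zero, zero_add] at this
  refine this.congr fun n => ?_
  ring

/-- law of the normalised variable -/
noncomputable def lawM (n : ℕ) : MeasureTheory.Measure ℝ :=
  ((n : ENNReal) ^ n)⁻¹ • ∑ f : Fin n → Fin n, MeasureTheory.Measure.dirac (XX f)

lemma pow_self_ne (n : ℕ) : (n : ℝ) ^ n ≠ 0 := by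
  rcases Nat.eq_zero_or_pos n with h | h
  · subst h; simp
  · positivity

lemma pow_self_ne' (n : ℕ) : (n : ENNReal) ^ n ≠ 0 := by
  rcases Nat.eq_zero_or_pos n with h | h
  · subst h; simp
  · have : (n : ENNReal) ≠ 0 := by exact_mod_cast h.ne'
    exact pow_ne_zero _ this

lemma pow_self_ne_top (n : ℕ) : (n : ENNReal) ^ n ≠ ⊤ := ENNReal.pow_ne_top (ENNReal.natCast_ne_top n)

instance lawM_prob (n : ℕ) : MeasureTheory.IsProbabilityMeasure (lawM n) := by
  constructor
  unfold lawM
  rw [MeasureTheory.Measure.smul_apply, MeasureTheory.Measure.finsetSum_apply]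
  simp only [MeasureTheory.measure_univ, Finset.sum_const, Finset.card_univ, Fintype.card_fun,
    Fintype.card_fin, nsmul_eq_mul, mul_one, smul_eq_mul]
  push_cast
  exact ENNReal.inv_mul_cancel (pow_self_ne' n) (pow_self_ne_top n)

lemma toReal_pow_self (n : ℕ) : (((n : ENNReal) ^ n)⁻¹).toReal = ((n : ℝ) ^ n)⁻¹ := by
  rw [ENNReal.toReal_inv, ENNReal.toReal_pow, ENNReal.toReal_natCast]

lemma lawM_charFun (n : ℕ) (θ : ℝ) : MeasureTheory.charFun (lawM n) θ
    = (∑ f : Fin n → Fin n, Complex.exp (((θ * XX f : ℝ) : ℂ) * Complex.I)) / (n : ℂ) ^ n := by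
  rw [MeasureTheory.charFun_apply_real]
  unfold lawM
  rw [MeasureTheory.integral_smul_measure, MeasureTheory.integral_finsetSum_measure]
  · simp only [MeasureTheory.integral_dirac, toReal_pow_self]
    rw [Complex.real_smul, div_eq_inv_mul]
    push_cast
    rfl
  · intro f _
    exact MeasureTheory.integrable_dirac (by simp)

lemma lawM_Iic (n : ℕ) (x : ℝ) : (lawM n (Set.Iic x)).toReal
    = ((Finset.univ.filter fun f : Fin n → Fin n => XX f ≤ x).card : ℝ) / (n : ℝ) ^ n := by
  unfold lawM
  rw [MeasureTheory.Measure.smul_apply, MeasureTheory.Measure.finsetSum_apply]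
  simp only [MeasureTheory.Measure.dirac_apply' _ measurableSet_Iic, Set.indicator_apply, Set.mem_Iic,
    Pi.one_apply, smul_eq_mul]
  rw [ENNReal.toReal_mul, toReal_pow_self, Finset.sum_boole, ENNReal.toReal_natCast, div_eq_inv_mul]

lemma gauss_Iic (x : ℝ) : (ProbabilityTheory.gaussianReal 0 1 (Set.Iic x)).toReal
    = (1 / Real.sqrt (2 * Real.pi)) * ∫ t in Set.Iic x, Real.exp (-t ^ 2 / 2) := by
  rw [ProbabilityTheory.gaussianReal_apply_eq_integral _ one_ne_zero, ENNReal.toReal_ofReal]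
  · rw [← MeasureTheory.integral_const_mul]
    refine MeasureTheory.integral_congr_ae (Filter.Eventually.of_forall fun t => ?_)
    simp [ProbabilityTheory.gaussianPDFReal]
  · exact MeasureTheory.integral_nonneg fun t => ProbabilityTheory.gaussianPDFReal_nonneg _ _ _

lemma clt (x : ℝ) : Filter.Tendsto (fun n : ℕ =>
    ((Finset.univ.filter fun f : Fin n → Fin n => XX f ≤ x).card : ℝ) / (n : ℝ) ^ n)
    Filter.atTop
    (nhds ((1 / Real.sqrt (2 * Real.pi)) * ∫ t in Set.Iic x, Real.exp (-t ^ 2 / 2))) := by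
  let μ : ℕ → MeasureTheory.ProbabilityMeasure ℝ := fun n => ⟨lawM n, lawM_prob n⟩
  let μ₀ : MeasureTheory.ProbabilityMeasure ℝ := ⟨ProbabilityTheory.gaussianReal 0 1, inferInstance⟩
  have h : Filter.Tendsto μ Filter.atTop (nhds μ₀) := by
    apply MeasureTheory.ProbabilityMeasure.tendsto_of_tendsto_charFun
    intro θ
    have e : MeasureTheory.charFun (μ₀ : MeasureTheory.Measure ℝ) θ
        = Complex.exp (-((θ : ℂ) ^ 2 / 2)) := by
      change MeasureTheory.charFun (ProbabilityTheory.gaussianReal 0 1) θ = _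
      rw [ProbabilityTheory.charFun_gaussianReal]
      congr 1
      simp
    rw [e]
    exact (charT_tendsto θ).congr fun n => (lawM_charFun n θ).symm
  have h2 := MeasureTheory.ProbabilityMeasure.tendsto_measure_of_null_frontier_of_tendsto' h
    (E := Set.Iic x) (by
      rw [frontier_Iic]
      change ProbabilityTheory.gaussianReal 0 1 {x} = 0
      haveI := ProbabilityTheory.noAtoms_gaussianReal (μ := 0) (v := 1) one_ne_zero
      exact MeasureTheory.measure_singleton x)
  have h3 := (ENNReal.tendsto_toReal (MeasureTheory.measure_ne_top (μ₀ : MeasureTheory.Measure ℝ)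
    (Set.Iic x))).comp h2
  rw [← gauss_Iic]
  exact h3.congr fun n => lawM_Iic n x

end Aux

/-- Harris: a central limit theorem for `log T`. -/
theorem harris (x : ℝ) :
    Filter.Tendsto
      (fun n : ℕ =>
        ((Finset.univ.filter fun f : Fin n → Fin n =>
            (Real.log (T f) - (1 / 8) * (Real.log n) ^ 2) /
              ((1 / Real.sqrt 24) * (Real.log n) ^ ((3 : ℝ) / 2)) ≤ x).card : ℝ) /
          (n : ℝ) ^ n)
      Filter.atTop
      (nhds ((1 / Real.sqrt (2 * Real.pi)) * ∫ t in Set.Iic x, Real.exp (-t ^ 2 / 2))) := by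
  refine (clt x).congr fun n => ?_
  simp only [XX, bb]
  congr!

end IterMap
end

section
/- (Dénes) For every positive integer n and every f ∈ Ω_n, |O(f) − T(f)| < n, where O(f) is the number of distinct functions in the sequence f, f^{(2)}, f^{(3)}, … of compositional iterates of f. -/
open scoped Classical
open Function

namespace IterMap

theorem denes_mem {n : ℕ} (f : Fin n → Fin n) (m : ℕ) (hm : n ≤ m) :
    f^[m + n.factorial] = f^[m] := by
  funext v
  have key : ∃ i j : ℕ, i < j ∧ j ≤ n ∧ f^[i] v = f^[j] v := by
    obtain ⟨a, b, hab, h⟩ := Fintype.exists_ne_map_eq_of_card_lt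
      (fun i : Fin (n + 1) => f^[i.1] v) (by simp)
    have hne : a.1 ≠ b.1 := fun h => hab (Fin.ext h)
    rcases lt_or_gt_of_ne hne with h1 | h1
    · exact ⟨a, b, h1, by omega, h⟩
    · exact ⟨b, a, h1, by omega, h.symm⟩
  obtain ⟨i, j, hij, hj, h⟩ := key
  have hp : Function.IsPeriodicPt f (j - i) (f^[m] v) := by
    show f^[j - i] (f^[m] v) = f^[m] v
    rw [← Function.iterate_add_apply]
    have e1 : j - i + m = (m - i) + j := by omega
    have e2 : m = (m - i) + i := by omega
    rw [e1, Function.iterate_add_apply, ← h, ← Function.iterate_add_apply, ← e2]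
  have hd : (j - i) ∣ n.factorial := Nat.dvd_factorial (by omega) (by omega)
  rw [add_comm, Function.iterate_add_apply]
  exact hp.trans_dvd hd

theorem denes_T_spec {n : ℕ} (f : Fin n → Fin n) :
    0 < T f ∧ ∀ m, n ≤ m → f^[m + T f] = f^[m] :=
  Nat.sInf_mem (s := {T : ℕ | 0 < T ∧ ∀ m, n ≤ m → f^[m + T] = f^[m]})
    ⟨n.factorial, Nat.factorial_pos n, denes_mem f⟩

theorem denes_mul {n : ℕ} (f : Fin n → Fin n) (m : ℕ) (hm : n ≤ m) (k : ℕ) :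
    f^[m + T f * k] = f^[m] := by
  induction k with
  | zero => simp
  | succ k ih =>
    rw [Nat.mul_succ, ← add_assoc, (denes_T_spec f).2 _ (by omega), ih]

theorem denes_ne {n : ℕ} (f : Fin n → Fin n) (i j : ℕ) (hij : i < j) (hj : j < T f) :
    f^[n + i] ≠ f^[n + j] := by
  intro h
  have hpos := (denes_T_spec f).1
  have : T f ≤ j - i := by
    apply Nat.sInf_le
    refine ⟨by omega, fun m hm => ?_⟩
    have hle : i ≤ T f * i := Nat.le_mul_of_pos_left i hpos
    rw [← denes_mul f m hm i, ← denes_mul f (m + (j - i)) (by omega) i]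
    have e1 : m + (j - i) + T f * i = (m + T f * i - (n + i)) + (n + j) := by omega
    have e2 : m + T f * i = (m + T f * i - (n + i)) + (n + i) := by omega
    rw [e1, Function.iterate_add, ← h, ← Function.iterate_add, ← e2]
  omega

theorem denes_lower {n : ℕ} (hn : 0 < n) (f : Fin n → Fin n) : T f ≤ O f := by
  have := Nat.card_le_card_of_injective
    (fun i : Fin (T f) => (⟨f^[n + i.1], n + i.1, by omega, rfl⟩ :
      {g : Fin n → Fin n // ∃ t, 0 < t ∧ g = f^[t]})) (by
      intro a b hab
      have h : f^[n + a.1] = f^[n + b.1] := congrArg Subtype.val hab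
      by_contra hne
      have hne' : a.1 ≠ b.1 := fun h => hne (Fin.ext h)
      rcases lt_or_gt_of_ne hne' with h1 | h1
      · exact denes_ne f _ _ h1 b.2 h
      · exact denes_ne f _ _ h1 a.2 h.symm)
  simpa [O] using this

theorem denes_upper {n : ℕ} (hn : 0 < n) (f : Fin n → Fin n) : O f ≤ n - 1 + T f := by
  have := Nat.card_le_card_of_surjective
    (fun i : Fin (n - 1 + T f) => (⟨f^[i.1 + 1], i.1 + 1, by omega, rfl⟩ :
      {g : Fin n → Fin n // ∃ t, 0 < t ∧ g = f^[t]})) (by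
      rintro ⟨g, t, ht, rfl⟩
      have hpos := (denes_T_spec f).1
      rcases lt_or_ge t n with h | h
      · refine ⟨⟨t - 1, by omega⟩, Subtype.ext ?_⟩
        show f^[t - 1 + 1] = f^[t]
        rw [Nat.sub_add_cancel ht]
      · have hlt := Nat.mod_lt (t - n) hpos
        refine ⟨⟨n - 1 + (t - n) % T f, by omega⟩, Subtype.ext ?_⟩
        show f^[n - 1 + (t - n) % T f + 1] = f^[t]
        have hd := Nat.mod_add_div (t - n) (T f)
        have e1 : n - 1 + (t - n) % T f + 1 = n + (t - n) % T f := by omega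
        have e2 : t = n + (t - n) % T f + T f * ((t - n) / T f) := by omega
        rw [e1, ← denes_mul f (n + (t - n) % T f) (by omega) ((t - n) / T f), ← e2])
  simpa [O] using this

/-- Dénes: `|O(f) - T(f)| < n`. -/
theorem denes (n : ℕ) (hn : 0 < n) (f : Fin n → Fin n) :
    |(O f : ℤ) - (T f : ℤ)| < (n : ℤ) := by
  have h1 := denes_lower hn f
  have h2 := denes_upper hn f
  rw [abs_lt]
  omega

end IterMap
end
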